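/- Let f ∈ C⁰([0,∞)) ∩ C²((0,∞)) be nondecreasing and convex with f > 0 on (0,∞), assume q₀ = lim_{u→0⁺} q(u) exists with conjugate exponent p₀, and assume p₀ is subcritical, i.e. either N ≤ 2 and p₀ < +∞, or N ≥ 3 and p₀ < p_S(N). Assume moreover the global inequality (p₀+1)F(s) ≥ s f(s) for all s ≥ 0, where F is the antiderivative of f vanishing at 0. Then any bounded nonnegative solution u ∈ C²(ℝ^N) of −Δu = f(u) in ℝ^N which is stable outside a compact set satisfies u ≡ 0. -/

import Mathlib

open MeasureTheory Filter Topology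
open scoped ENNReal

/-- The Laplacian of `u : ℝ^N → ℝ`. -/
noncomputable def lap {N : ℕ} (u : EuclideanSpace ℝ (Fin N) → ℝ)
    (x : EuclideanSpace ℝ (Fin N)) : ℝ :=
  ∑ i : Fin N, iteratedFDeriv ℝ 2 u x ![EuclideanSpace.single i 1, EuclideanSpace.single i 1]

/-- `u` is a stable solution w.r.t. the linearized weight `g = f'`:
`∫ f'(u) φ² ≤ ∫ |∇φ|²` for all `φ ∈ C¹_c(ℝ^N)`. -/
def Stable {N : ℕ} (g : ℝ → ℝ) (u : EuclideanSpace ℝ (Fin N) → ℝ) : Prop :=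
  ∀ φ : EuclideanSpace ℝ (Fin N) → ℝ, ContDiff ℝ 1 φ → HasCompactSupport φ →
    ∫ x, g (u x) * (φ x) ^ 2 ≤ ∫ x, ‖gradient φ x‖ ^ 2

/-- `u` is stable outside the set `K` : the stability inequality holds for all
`φ ∈ C¹_c(ℝ^N \ K)`. -/
def StableOutside {N : ℕ} (g : ℝ → ℝ) (u : EuclideanSpace ℝ (Fin N) → ℝ)
    (K : Set (EuclideanSpace ℝ (Fin N))) : Prop :=
  ∀ φ : EuclideanSpace ℝ (Fin N) → ℝ, ContDiff ℝ 1 φ → HasCompactSupport φ →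
    tsupport φ ⊆ Kᶜ →
    ∫ x, g (u x) * (φ x) ^ 2 ≤ ∫ x, ‖gradient φ x‖ ^ 2

/-- The quantity `q(u) = f'(u)²/(f(u) f''(u)) ∈ [0,∞]`, with the convention
`q(u) = +∞` when `f(u) f''(u) = 0`. -/
noncomputable def qfun (f : ℝ → ℝ) (t : ℝ) : ℝ≥0∞ :=
  if f t * deriv (deriv f) t = 0 then ⊤
  else ENNReal.ofReal ((deriv f t) ^ 2 / (f t * deriv (deriv f) t))

/-- The Joseph–Lundgren exponent `p_c(N)` (for `N ≥ 11`). -/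
noncomputable def pc (N : ℕ) : ℝ :=
  (((N : ℝ) - 2) ^ 2 - 4 * N + 8 * Real.sqrt ((N : ℝ) - 1)) / (((N : ℝ) - 2) * ((N : ℝ) - 10))

theorem hasDerivAt_primitive {g : ℝ → ℝ} (hg : Continuous g) (t : ℝ) :
    HasDerivAt (fun t => ∫ s in (0:ℝ)..t, g s) (g t) t :=
  intervalIntegral.integral_hasDerivAt_right (hg.intervalIntegrable _ _)
    hg.aestronglyMeasurable.stronglyMeasurableAtFilter hg.continuousAt

theorem primitive_le_mul {g : ℝ → ℝ} (hg : Continuous g) (hmono : Monotone g) {t : ℝ}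
    (ht : 0 ≤ t) : ∫ s in (0:ℝ)..t, g s ≤ t * g t := by
  have h := intervalIntegral.integral_mono_on ht (hg.intervalIntegrable 0 t)
    (continuous_const.intervalIntegrable (μ := volume) 0 t) (g := fun _ => g t)
    (fun x hx => hmono hx.2)
  simpa using h

theorem primitive_nonneg {g : ℝ → ℝ} (hnn : ∀ t, 0 ≤ g t) {t : ℝ} (ht : 0 ≤ t) :
    0 ≤ ∫ s in (0:ℝ)..t, g s :=
  intervalIntegral.integral_nonneg ht fun x _ => hnn x

theorem primitive_pos {g : ℝ → ℝ} (hg : Continuous g) (hpos : ∀ t, 0 < t → 0 < g t) {t : ℝ}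
    (ht : 0 < t) : 0 < ∫ s in (0:ℝ)..t, g s :=
  intervalIntegral.intervalIntegral_pos_of_pos_on (hg.intervalIntegrable _ _)
    (fun x hx => hpos x hx.1) ht

/-- A function dominated by its primitive as in `t g(t) ≤ (p + 1) ∫₀ᵗ g` lies above a multiple of
`t ^ p` on bounded intervals. -/
theorem exists_rpow_le_of_mul_le_primitive {g : ℝ → ℝ} (hg : Continuous g) (hmono : Monotone g)
    (hpos : ∀ t, 0 < t → 0 < g t) {p M : ℝ} (hM : 0 < M)
    (hglob : ∀ t, 0 ≤ t → t * g t ≤ (p + 1) * ∫ s in (0:ℝ)..t, g s) :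
    ∃ c > 0, ∀ t, 0 < t → t ≤ M → c * t ^ p ≤ g t := by
  set P : ℝ → ℝ := fun t => ∫ s in (0:ℝ)..t, g s with hP
  have hder : ∀ t, HasDerivAt P (g t) t := hasDerivAt_primitive hg
  have hder2 : ∀ t, 0 < t → HasDerivAt (fun t => P t * t ^ (-(p + 1)))
      (g t * t ^ (-(p + 1)) + P t * (-(p + 1) * t ^ (-(p + 1) - 1))) t := fun t ht =>
    (hder t).mul (Real.hasDerivAt_rpow_const (Or.inl ht.ne'))
  have hanti : AntitoneOn (fun t => P t * t ^ (-(p + 1))) (Set.Ioi 0) := by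
    apply antitoneOn_of_deriv_nonpos (convex_Ioi 0)
    · exact fun t ht => (hder2 t ht).continuousAt.continuousWithinAt
    · rw [interior_Ioi]
      exact fun t ht => (hder2 t ht).differentiableAt.differentiableWithinAt
    · rw [interior_Ioi]
      intro t ht
      have ht : 0 < t := ht
      rw [(hder2 t ht).deriv]
      have h1 : t ^ (-(p + 1)) = t ^ (-(p + 1) - 1) * t := by
        rw [← Real.rpow_add_one ht.ne']; ring_nf
      rw [h1]
      have h2 := hglob t ht.le
      have h3 : 0 < t ^ (-(p + 1) - 1) := Real.rpow_pos_of_pos ht _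
      have : g t * (t ^ (-(p + 1) - 1) * t) + P t * (-(p + 1) * t ^ (-(p + 1) - 1))
        = t ^ (-(p + 1) - 1) * (t * g t - (p + 1) * P t) := by ring
      rw [this]
      exact mul_nonpos_of_nonneg_of_nonpos h3.le (by simp only [hP]; linarith)
  refine ⟨P M * M ^ (-(p + 1)), mul_pos (primitive_pos hg hpos hM)
    (Real.rpow_pos_of_pos hM _), fun t ht htM => ?_⟩
  have h1 : P M * M ^ (-(p + 1)) ≤ P t * t ^ (-(p + 1)) := hanti ht hM htM
  have h2 : P t ≤ t * g t := primitive_le_mul hg hmono ht.le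
  have h3 : 0 < t ^ p := Real.rpow_pos_of_pos ht _
  calc P M * M ^ (-(p + 1)) * t ^ p ≤ (t * g t) * t ^ (-(p + 1)) * t ^ p := by
        refine mul_le_mul_of_nonneg_right ?_ h3.le
        exact h1.trans (mul_le_mul_of_nonneg_right h2 (Real.rpow_pos_of_pos ht _).le)
    _ = g t := by
        rw [mul_assoc, ← Real.rpow_add ht]
        have : -(p + 1) + p = -1 := by ring
        rw [this, Real.rpow_neg_one]
        field_simp

theorem exists_rpow_le_of_le {g : ℝ → ℝ} {c p p' M : ℝ} (hM : 0 < M) (hp : p ≤ p') (hp' : 0 < p')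
    (hc : 0 < c) (hg : ∀ t, 0 < t → t ≤ M → c * t ^ p ≤ g t) (hg0 : 0 ≤ g 0) :
    ∃ c > 0, ∀ t, 0 ≤ t → t ≤ M → c * t ^ p' ≤ g t := by
  refine ⟨c * M ^ (p - p'), mul_pos hc (Real.rpow_pos_of_pos hM _), fun t ht htM => ?_⟩
  rcases ht.eq_or_lt with rfl | ht
  · simpa [Real.zero_rpow hp'.ne'] using hg0
  refine le_trans ?_ (hg t ht htM)
  have h1 : M ^ (p - p') ≤ t ^ (p - p') := Real.rpow_le_rpow_of_nonpos ht htM (by linarith)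
  have h2 : t ^ p = t ^ (p - p') * t ^ p' := by rw [← Real.rpow_add ht]; ring_nf
  rw [h2, mul_assoc]
  have := Real.rpow_pos_of_pos ht p'
  gcongr

section convex
variable {f : ℝ → ℝ}

theorem deriv_nonneg_of_monotoneOn_Ici (hmono : MonotoneOn f (Set.Ici 0)) {t : ℝ} (ht : 0 < t) :
    0 ≤ deriv f t := by
  have h := hmono.derivWithin_nonneg (x := t)
  rwa [derivWithin_of_mem_nhds (Ici_mem_nhds ht)] at h

theorem hasDerivAt_of_contDiffOn_Ioi (hC2 : ContDiffOn ℝ 2 f (Set.Ioi 0)) {t : ℝ} (ht : 0 < t) :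
    HasDerivAt f (deriv f t) t :=
  ((hC2.differentiableOn (by norm_num)).differentiableAt (Ioi_mem_nhds ht)).hasDerivAt

theorem hasDerivAt_deriv_of_contDiffOn_Ioi (hC2 : ContDiffOn ℝ 2 f (Set.Ioi 0)) {t : ℝ}
    (ht : 0 < t) : HasDerivAt (deriv f) (deriv (deriv f) t) t := by
  have h : ContDiffOn ℝ 1 (deriv f) (Set.Ioi 0) :=
    hC2.deriv_of_isOpen isOpen_Ioi (by norm_num)
  exact ((h.differentiableOn (by norm_num)).differentiableAt (Ioi_mem_nhds ht)).hasDerivAt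

theorem monotoneOn_deriv_of_convexOn_Ioi (hC2 : ContDiffOn ℝ 2 f (Set.Ioi 0))
    (hconv : ConvexOn ℝ (Set.Ioi 0) f) : MonotoneOn (deriv f) (Set.Ioi 0) :=
  hconv.monotoneOn_deriv fun _ ht => (hasDerivAt_of_contDiffOn_Ioi hC2 ht).differentiableAt

theorem deriv_deriv_nonneg_of_convexOn_Ioi (hC2 : ContDiffOn ℝ 2 f (Set.Ioi 0))
    (hconv : ConvexOn ℝ (Set.Ioi 0) f) {t : ℝ} (ht : 0 < t) : 0 ≤ deriv (deriv f) t := by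
  have h := (monotoneOn_deriv_of_convexOn_Ioi hC2 hconv).derivWithin_nonneg (x := t)
  rwa [derivWithin_of_mem_nhds (Ioi_mem_nhds ht)] at h

theorem le_mul_deriv_of_convexOn_Ioi (hcont : ContinuousOn f (Set.Ici 0))
    (hC2 : ContDiffOn ℝ 2 f (Set.Ioi 0)) (hconv : ConvexOn ℝ (Set.Ioi 0) f) (h0 : f 0 = 0)
    {t : ℝ} (ht : 0 < t) : f t ≤ t * deriv f t := by
  obtain ⟨c, hc, hc'⟩ := exists_deriv_eq_slope f ht (hcont.mono Set.Icc_subset_Ici_self)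
    fun x hx => (hasDerivAt_of_contDiffOn_Ioi hC2 hx.1).differentiableAt.differentiableWithinAt
  have h1 : deriv f c ≤ deriv f t :=
    monotoneOn_deriv_of_convexOn_Ioi hC2 hconv hc.1 ht hc.2.le
  rw [hc', h0, sub_zero, sub_zero, div_le_iff₀ ht] at h1
  linarith

/-- If `f f'' ≥ k f'²` near `0` then `t f' - f` dominates a multiple of `f` on bounded
intervals. -/
theorem exists_mul_le_mul_deriv_sub (hcont : ContinuousOn f (Set.Ici 0))
    (hC2 : ContDiffOn ℝ 2 f (Set.Ioi 0)) (hconv : ConvexOn ℝ (Set.Ioi 0) f)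
    (hmono : MonotoneOn f (Set.Ici 0)) (hpos : ∀ t : ℝ, 0 < t → 0 < f t) (h0 : f 0 = 0)
    {k ε : ℝ} (hk : 0 < k) (hε : 0 < ε)
    (hf : ∀ t, 0 < t → t ≤ ε → k * deriv f t ^ 2 ≤ f t * deriv (deriv f) t) {M : ℝ} (hM : 0 < M) :
    ∃ δ > 0, ∀ t, 0 < t → t ≤ M → δ * f t ≤ t * deriv f t - f t := by
  have hg : ∀ (d t : ℝ), 0 < t → HasDerivAt (fun t => t * deriv f t - (1 + d) * f t)
      (t * deriv (deriv f) t - d * deriv f t) t := by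
    intro d t ht
    have h := ((hasDerivAt_id t).mul (hasDerivAt_deriv_of_contDiffOn_Ioi hC2 ht)).sub
      ((hasDerivAt_of_contDiffOn_Ioi hC2 ht).const_mul (1 + d))
    refine h.congr_deriv ?_
    simp only [id]; ring
  have hd0 : ∀ t, 0 < t → 0 ≤ deriv f t := fun t ht => deriv_nonneg_of_monotoneOn_Ici hmono ht
  have hsmall : ∀ t, 0 < t → t ≤ ε → k * f t ≤ t * deriv f t - f t := by
    intro t ht htε
    have hmon : MonotoneOn (fun t => t * deriv f t - (1 + k) * f t) (Set.Ioc 0 ε) := by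
      apply monotoneOn_of_deriv_nonneg (convex_Ioc 0 ε)
      · exact fun t ht => (hg k t ht.1).continuousAt.continuousWithinAt
      · rw [interior_Ioc]
        exact fun t ht => (hg k t ht.1).differentiableAt.differentiableWithinAt
      · rw [interior_Ioc]
        intro t ht
        rw [(hg k t ht.1).deriv]
        have h1 := hf t ht.1 ht.2.le
        have h2 := le_mul_deriv_of_convexOn_Ioi hcont hC2 hconv h0 ht.1
        have h3 := hpos t ht.1
        have h4 := hd0 t ht.1
        have h5 : k * deriv f t * f t ≤ t * deriv (deriv f) t * f t := by
          calc k * deriv f t * f t ≤ k * deriv f t * (t * deriv f t) := by gcongr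
            _ = t * (k * deriv f t ^ 2) := by ring
            _ ≤ t * (f t * deriv (deriv f) t) := by
              have := ht.1
              gcongr
            _ = _ := by ring
        linarith [le_of_mul_le_mul_right h5 h3]
    have hlim : Tendsto (fun s => -((1 + k) * f s)) (𝓝[>] 0) (𝓝 0) := by
      have h1 : Tendsto f (𝓝[>] 0) (𝓝 (f 0)) :=
        (hcont 0 Set.self_mem_Ici).mono_left (nhdsWithin_mono _ Set.Ioi_subset_Ici_self)
      rw [h0] at h1
      simpa using (h1.const_mul (1 + k)).neg
    have h := le_of_tendsto hlim (b := t * deriv f t - (1 + k) * f t) (by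
      filter_upwards [Ioc_mem_nhdsGT ht] with s hs
      refine le_trans ?_ (hmon ⟨hs.1, hs.2.trans htε⟩ ⟨ht, htε⟩ hs.2)
      have := mul_nonneg hs.1.le (hd0 s hs.1)
      simp only; linarith)
    linarith
  have hmon : MonotoneOn (fun t => t * deriv f t - (1 + 0) * f t) (Set.Ioi 0) := by
    apply monotoneOn_of_deriv_nonneg (convex_Ioi 0)
    · exact fun t ht => (hg 0 t ht).continuousAt.continuousWithinAt
    · rw [interior_Ioi]
      exact fun t ht => (hg 0 t ht).differentiableAt.differentiableWithinAt
    · rw [interior_Ioi]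
      intro t ht
      rw [(hg 0 t ht).deriv]
      have := mul_nonneg (le_of_lt ht) (deriv_deriv_nonneg_of_convexOn_Ioi hC2 hconv ht)
      linarith
  have hfε := hpos ε hε
  have hfM := hpos M hM
  refine ⟨min k (k * f ε / f M), lt_min hk (by positivity), fun t ht htM => ?_⟩
  have hft := hpos t ht
  rcases le_total t ε with h | h
  · exact (mul_le_mul_of_nonneg_right (min_le_left _ _) hft.le).trans (hsmall t ht h)
  · have h1 := hmon hε ht h
    have h2 := hsmall ε hε le_rfl
    have h3 : f t ≤ f M := hmono ht.le hM.le htM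
    have h4 : min k (k * f ε / f M) * f t ≤ k * f ε := by
      calc min k (k * f ε / f M) * f t ≤ (k * f ε / f M) * f M := by
            gcongr
            exact min_le_right _ _
        _ = k * f ε := by field_simp
    simp only at h1
    linarith

end convex

theorem one_le_of_conjugate {p₀ : ℝ} {q₀ : ℝ≥0∞} (hpq : 1 / ENNReal.ofReal p₀ + 1 / q₀ = 1) :
    1 ≤ p₀ := by
  have h1 : (ENNReal.ofReal p₀)⁻¹ ≤ 1 := by
    rw [← hpq, one_div]; exact le_self_add
  rw [ENNReal.inv_le_one] at h1
  exact ENNReal.one_le_ofReal.1 h1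

theorem ne_top_of_conjugate {p₀ : ℝ} {q₀ : ℝ≥0∞} (hpq : 1 / ENNReal.ofReal p₀ + 1 / q₀ = 1)
    (hp : 1 < p₀) : q₀ ≠ ⊤ := by
  rintro rfl
  simp only [one_div, ENNReal.inv_top, add_zero, ENNReal.inv_eq_one] at hpq
  rw [ENNReal.ofReal_eq_one] at hpq
  linarith

theorem exists_mul_deriv_sq_le {f : ℝ → ℝ} (hC2 : ContDiffOn ℝ 2 f (Set.Ioi 0))
    (hconv : ConvexOn ℝ (Set.Ioi 0) f) (hpos : ∀ t : ℝ, 0 < t → 0 < f t) {q₀ : ℝ≥0∞}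
    (hq : Tendsto (qfun f) (𝓝[>] (0:ℝ)) (𝓝 q₀)) (hq₀ : q₀ ≠ ⊤) :
    ∃ k > 0, ∃ ε > 0, ∀ t, 0 < t → t ≤ ε → k * deriv f t ^ 2 ≤ f t * deriv (deriv f) t := by
  have hlt : q₀ < q₀ + 1 := ENNReal.lt_add_right hq₀ one_ne_zero
  have htop : q₀ + 1 ≠ ⊤ := ENNReal.add_ne_top.2 ⟨hq₀, ENNReal.one_ne_top⟩
  have hQ : 0 < (q₀ + 1).toReal := ENNReal.toReal_pos (by simp) htop
  have hev := hq.eventually (gt_mem_nhds hlt)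
  obtain ⟨ε, hε, hev⟩ := (mem_nhdsGT_iff_exists_Ioc_subset).1 hev
  refine ⟨((q₀ + 1).toReal)⁻¹, inv_pos.2 hQ, ε, hε, fun t ht htε => ?_⟩
  have h := hev ⟨ht, htε⟩
  simp only [Set.mem_ofPred_eq, qfun] at h
  split_ifs at h with h0
  · exact absurd h not_top_lt
  · have hnn : 0 < f t * deriv (deriv f) t :=
      lt_of_le_of_ne (mul_nonneg (hpos t ht).le (deriv_deriv_nonneg_of_convexOn_Ioi hC2 hconv ht))
        (Ne.symm h0)
    have h1 : deriv f t ^ 2 / (f t * deriv (deriv f) t) ≤ (q₀ + 1).toReal := by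
      rw [← ENNReal.ofReal_le_iff_le_toReal htop]
      exact h.le
    rw [div_le_iff₀ hnn] at h1
    rw [inv_mul_le_iff₀ hQ]
    exact h1

section calculus
variable {N : ℕ} {g h : EuclideanSpace ℝ (Fin N) → ℝ}

/-- The partial derivative of `g` in the `i`-th coordinate direction. -/
noncomputable def pderiv (i : Fin N) (g : EuclideanSpace ℝ (Fin N) → ℝ)
    (x : EuclideanSpace ℝ (Fin N)) : ℝ :=
  fderiv ℝ g x (EuclideanSpace.single i 1)

theorem pderiv_add (i : Fin N) {x : EuclideanSpace ℝ (Fin N)} (hg : DifferentiableAt ℝ g x)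
    (hh : DifferentiableAt ℝ h x) :
    pderiv i (fun x => g x + h x) x = pderiv i g x + pderiv i h x := by
  simp [pderiv, fderiv_fun_add hg hh]

theorem pderiv_sub (i : Fin N) {x : EuclideanSpace ℝ (Fin N)} (hg : DifferentiableAt ℝ g x)
    (hh : DifferentiableAt ℝ h x) :
    pderiv i (fun x => g x - h x) x = pderiv i g x - pderiv i h x := by
  simp [pderiv, fderiv_fun_sub hg hh]

theorem pderiv_mul (i : Fin N) {x : EuclideanSpace ℝ (Fin N)} (hg : DifferentiableAt ℝ g x)
    (hh : DifferentiableAt ℝ h x) :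
    pderiv i (fun x => g x * h x) x = g x * pderiv i h x + pderiv i g x * h x := by
  simp [pderiv, fderiv_fun_mul hg hh, mul_comm]

theorem pderiv_sum {ι : Type*} (s : Finset ι) (i : Fin N) {A : ι → EuclideanSpace ℝ (Fin N) → ℝ}
    {x : EuclideanSpace ℝ (Fin N)} (hA : ∀ j ∈ s, DifferentiableAt ℝ (A j) x) :
    pderiv i (fun x => ∑ j ∈ s, A j x) x = ∑ j ∈ s, pderiv i (A j) x := by
  simp [pderiv, fderiv_fun_sum hA]

theorem pderiv_const_mul (i : Fin N) (c : ℝ) (g : EuclideanSpace ℝ (Fin N) → ℝ)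
    (x : EuclideanSpace ℝ (Fin N)) :
    pderiv i (fun x => c * g x) x = c * pderiv i g x := by
  have : (fun x => c * g x) = c • g := rfl
  simp [pderiv, this, fderiv_const_smul_field]

theorem pderiv_pow (i : Fin N) {x : EuclideanSpace ℝ (Fin N)} (hg : DifferentiableAt ℝ g x)
    (n : ℕ) : pderiv i (fun x => g x ^ n) x = n * g x ^ (n - 1) * pderiv i g x := by
  simp [pderiv, fderiv_fun_pow n hg]

theorem pderiv_comp (i : Fin N) {x : EuclideanSpace ℝ (Fin N)} {P : ℝ → ℝ} {P' : ℝ}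
    (hP : HasDerivAt P P' (g x)) (hg : DifferentiableAt ℝ g x) :
    pderiv i (fun x => P (g x)) x = P' * pderiv i g x := by
  have h := (hP.comp_hasFDerivAt x hg.hasFDerivAt).fderiv
  simp only [Function.comp_def] at h
  simp [pderiv, h]

theorem pderiv_coord (i j : Fin N) (x : EuclideanSpace ℝ (Fin N)) :
    pderiv i (fun x : EuclideanSpace ℝ (Fin N) => x j) x = if j = i then 1 else 0 := by
  have h : fderiv ℝ (fun x : EuclideanSpace ℝ (Fin N) => x j) x
      = (EuclideanSpace.proj j : EuclideanSpace ℝ (Fin N) →L[ℝ] ℝ) :=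
    (EuclideanSpace.proj j : EuclideanSpace ℝ (Fin N) →L[ℝ] ℝ).fderiv
  simp [pderiv, h]

theorem pderiv_comp_smul (i : Fin N) (c : ℝ) (hg : Differentiable ℝ g)
    (x : EuclideanSpace ℝ (Fin N)) :
    pderiv i (fun x => g (c • x)) x = c * pderiv i g (c • x) := by
  have h1 : HasFDerivAt (fun x : EuclideanSpace ℝ (Fin N) => c • x)
      (c • ContinuousLinearMap.id ℝ (EuclideanSpace ℝ (Fin N))) x :=
    (hasFDerivAt_id x).const_smul c
  have h := ((hg (c • x)).hasFDerivAt.comp x h1).fderiv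
  simp only [Function.comp_def] at h
  simp [pderiv, h]

theorem contDiff_pderiv (i : Fin N) {n m : WithTop ℕ∞} (hg : ContDiff ℝ n g) (hm : m + 1 ≤ n) :
    ContDiff ℝ m (pderiv i g) :=
  (hg.fderiv_right hm).clm_apply contDiff_const

theorem continuous_pderiv (i : Fin N) (hg : ContDiff ℝ 1 g) : Continuous (pderiv i g) :=
  (contDiff_pderiv (m := 0) i hg (by norm_num)).continuous

theorem HasCompactSupport.pderiv (i : Fin N) (hg : HasCompactSupport g) :
    HasCompactSupport (pderiv i g) :=
  hg.fderiv_apply ℝ _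

theorem pderiv_comm (i j : Fin N) (hg : ContDiff ℝ 2 g) (x : EuclideanSpace ℝ (Fin N)) :
    pderiv i (pderiv j g) x = pderiv j (pderiv i g) x := by
  have hd : DifferentiableAt ℝ (fderiv ℝ g) x :=
    ((hg.fderiv_right (m := 1) (by norm_num)).differentiable (by norm_num)) x
  have key : ∀ a b : EuclideanSpace ℝ (Fin N),
      fderiv ℝ (fun y => fderiv ℝ g y a) x b = fderiv ℝ (fderiv ℝ g) x b a := by
    intro a b
    rw [fderiv_clm_apply hd (differentiableAt_const a)]
    simp
  exact (key _ _).trans (((hg.contDiffAt.isSymmSndFDerivAt (by simp)) _ _).trans (key _ _).symm)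

theorem lap_eq_sum_pderiv (hg : ContDiff ℝ 2 g) (x : EuclideanSpace ℝ (Fin N)) :
    lap g x = ∑ i, pderiv i (pderiv i g) x := by
  have hd : DifferentiableAt ℝ (fderiv ℝ g) x :=
    ((hg.fderiv_right (m := 1) (by norm_num)).differentiable (by norm_num)) x
  refine Finset.sum_congr rfl fun i _ => ?_
  rw [iteratedFDeriv_two_apply]
  change _ = fderiv ℝ (fun y => fderiv ℝ g y _) x _
  rw [fderiv_clm_apply hd (differentiableAt_const _)]
  simp

theorem norm_gradient_sq (g : EuclideanSpace ℝ (Fin N) → ℝ)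
    (x : EuclideanSpace ℝ (Fin N)) :
    ‖gradient g x‖ ^ 2 = ∑ i, pderiv i g x ^ 2 := by
  rw [EuclideanSpace.norm_sq_eq]
  refine Finset.sum_congr rfl fun i _ => ?_
  have h : gradient g x i = pderiv i g x := by
    rw [pderiv, ← InnerProductSpace.toDual_symm_apply (𝕜 := ℝ), ← gradient, real_inner_comm,
      EuclideanSpace.inner_single_left]
    simp
  rw [h, Real.norm_eq_abs, sq_abs]

theorem integral_pderiv_eq_zero (i : Fin N) (hg : ContDiff ℝ 1 g) (hs : HasCompactSupport g) :
    ∫ x, pderiv i g x = 0 := by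
  have h := integral_mul_fderiv_eq_neg_fderiv_mul_of_integrable (μ := volume)
    (f := fun _ : EuclideanSpace ℝ (Fin N) => (1 : ℝ)) (g := g)
    (v := EuclideanSpace.single i 1) (by simp)
    (by simp only [one_mul]
        exact (continuous_pderiv i hg).integrable_of_hasCompactSupport (hs.pderiv i))
    (by simpa using hg.continuous.integrable_of_hasCompactSupport hs)
    (fun _ _ => differentiableAt_const _) (fun x _ => hg.differentiable (by norm_num) x)
  simpa [pderiv] using h

theorem integral_divergence_eq_zero {W : Fin N → EuclideanSpace ℝ (Fin N) → ℝ}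
    (hW : ∀ i, ContDiff ℝ 1 (W i)) (hs : ∀ i, HasCompactSupport (W i)) :
    ∫ x, ∑ i, pderiv i (W i) x = 0 := by
  rw [integral_finsetSum _ fun i _ =>
    (continuous_pderiv i (hW i)).integrable_of_hasCompactSupport ((hs i).pderiv i)]
  exact Finset.sum_eq_zero fun i _ => integral_pderiv_eq_zero i (hW i) (hs i)

end calculus

section cutoff
variable {N : ℕ}

theorem hasCompactSupport_of_le_norm {g : EuclideanSpace ℝ (Fin N) → ℝ} {r : ℝ}
    (hg : ∀ x, r < ‖x‖ → g x = 0) : HasCompactSupport g :=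
  HasCompactSupport.intro (isCompact_closedBall 0 r) fun x hx =>
    hg x (by simpa [dist_zero_right] using hx)

theorem hasCompactSupport_sum {A : Fin N → EuclideanSpace ℝ (Fin N) → ℝ}
    (hA : ∀ i, HasCompactSupport (A i)) : HasCompactSupport fun x => ∑ i, A i x :=
  HasCompactSupport.intro (isCompact_iUnion hA) fun _ hx => Finset.sum_eq_zero fun i _ =>
    image_eq_zero_of_notMem_tsupport fun h => hx (Set.mem_iUnion.2 ⟨i, h⟩)

theorem HasCompactSupport.fun_sq {g : EuclideanSpace ℝ (Fin N) → ℝ} (hg : HasCompactSupport g) :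
    HasCompactSupport fun x => g x ^ 2 :=
  HasCompactSupport.intro hg fun x hx => by simp [image_eq_zero_of_notMem_tsupport hx]

theorem exists_cutoff_ball (N : ℕ) (a b : ℝ) (ha : 0 < a) (hab : a < b) :
    ∃ ζ : EuclideanSpace ℝ (Fin N) → ℝ, ContDiff ℝ 2 ζ ∧ (∀ x, 0 ≤ ζ x) ∧ (∀ x, ζ x ≤ 1) ∧
      (∀ x, ‖x‖ ≤ a → ζ x = 1) ∧ (∀ x, b ≤ ‖x‖ → ζ x = 0) := by
  let φ : ContDiffBump (0 : EuclideanSpace ℝ (Fin N)) := ⟨a, b, ha, hab⟩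
  refine ⟨φ, φ.contDiff, fun x => φ.nonneg, fun x => φ.le_one, fun x hx => ?_, fun x hx => ?_⟩
  · exact φ.one_of_mem_closedBall (by simpa [dist_zero_right] using hx)
  · exact φ.zero_of_le_dist (by simpa [dist_zero_right] using hx)

theorem exists_cutoff_annulus (N : ℕ) :
    ∃ α : EuclideanSpace ℝ (Fin N) → ℝ, ContDiff ℝ 2 α ∧ (∀ x, 0 ≤ α x) ∧ (∀ x, α x ≤ 1) ∧
      (∀ x, 1 ≤ ‖x‖ → ‖x‖ ≤ 2 → α x = 1) ∧ (∀ x, ‖x‖ ≤ 1 / 2 → α x = 0) ∧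
      (∀ x, 3 ≤ ‖x‖ → α x = 0) := by
  obtain ⟨ζ, h1, h2, h3, h4, h5⟩ := exists_cutoff_ball N 2 3 (by norm_num) (by norm_num)
  obtain ⟨ξ, k1, k2, k3, k4, k5⟩ := exists_cutoff_ball N (1 / 2) 1 (by norm_num) (by norm_num)
  refine ⟨fun x => ζ x * (1 - ξ x), h1.mul (contDiff_const.sub k1), fun x => ?_, fun x => ?_,
    fun x hx hx' => ?_, fun x hx => ?_, fun x hx => ?_⟩
  · exact mul_nonneg (h2 x) (sub_nonneg.2 (k3 x))
  · have := h2 x; have := h3 x; have := k2 x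
    nlinarith [mul_nonneg (h2 x) (k2 x)]
  · simp [h4 x hx', k5 x hx]
  · simp [k4 x hx]
  · simp [h5 x hx]

theorem exists_sum_pderiv_sq_le {g : EuclideanSpace ℝ (Fin N) → ℝ} (hg : ContDiff ℝ 1 g)
    (hs : HasCompactSupport g) : ∃ A > 0, ∀ x, ∑ i, pderiv i g x ^ 2 ≤ A := by
  have hc : Continuous fun x => ∑ i, pderiv i g x ^ 2 :=
    continuous_finsetSum _ fun i _ => (continuous_pderiv i hg).pow 2
  have hs' : HasCompactSupport fun x => ∑ i, pderiv i g x ^ 2 :=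
    hasCompactSupport_sum fun i => (hs.pderiv i).fun_sq
  obtain ⟨C, hC⟩ := hc.bounded_above_of_compact_support hs'
  exact ⟨max C 1, by positivity, fun x => (le_abs_self _).trans ((hC x).trans (le_max_left _ _))⟩

theorem exists_abs_laplacian_pow_le {ζ : EuclideanSpace ℝ (Fin N) → ℝ} (hζ : ContDiff ℝ 2 ζ)
    (hs : HasCompactSupport ζ) (h0 : ∀ x, 0 ≤ ζ x) (h1 : ∀ x, ζ x ≤ 1) (n : ℕ) :
    ∃ A > 0, ∀ x, |∑ i, pderiv i (pderiv i fun x => ζ x ^ (n + 2)) x| ≤ A * ζ x ^ n := by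
  have hd : Differentiable ℝ ζ := hζ.differentiable (by norm_num)
  have hc1 : ∀ i, ContDiff ℝ 1 (pderiv i ζ) := fun i => contDiff_pderiv i hζ (by norm_num)
  obtain ⟨A, hA, hA'⟩ := exists_sum_pderiv_sq_le (hζ.of_le (by norm_num)) hs
  have hc : Continuous fun x => ∑ i, pderiv i (pderiv i ζ) x :=
    continuous_finsetSum _ fun i _ => continuous_pderiv i (hc1 i)
  have hs' : HasCompactSupport fun x => ∑ i, pderiv i (pderiv i ζ) x :=
    hasCompactSupport_sum fun i => (hs.pderiv i).pderiv i
  obtain ⟨B, hB⟩ := hc.bounded_above_of_compact_support hs'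
  have key : ∀ x, ∑ i, pderiv i (pderiv i fun x => ζ x ^ (n + 2)) x
      = ((n + 2 : ℕ) * ζ x * ∑ i, pderiv i (pderiv i ζ) x
        + (n + 2 : ℕ) * (n + 1 : ℕ) * ∑ i, pderiv i ζ x ^ 2) * ζ x ^ n := by
    intro x
    rw [Finset.mul_sum, Finset.mul_sum, ← Finset.sum_add_distrib, Finset.sum_mul]
    refine Finset.sum_congr rfl fun i _ => ?_
    have e : (pderiv i fun x => ζ x ^ (n + 2))
        = fun x => ((n + 2 : ℕ) : ℝ) * (ζ x ^ (n + 1) * pderiv i ζ x) := by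
      ext y
      rw [pderiv_pow i (hd y)]
      simp only [Nat.add_succ_sub_one]
      ring
    rw [e, pderiv_const_mul, pderiv_mul (g := fun x => ζ x ^ (n + 1)) i ((hd.pow _) x)
      ((hc1 i).differentiable (by norm_num) x),
      pderiv_pow i (hd x)]
    simp only [Nat.add_sub_cancel]
    ring
  refine ⟨(n + 2 : ℕ) * |B| + (n + 2 : ℕ) * (n + 1 : ℕ) * A, by positivity, fun x => ?_⟩
  rw [key, abs_mul, abs_of_nonneg (pow_nonneg (h0 x) n)]
  refine mul_le_mul_of_nonneg_right ?_ (pow_nonneg (h0 x) n)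
  refine (abs_add_le _ _).trans (add_le_add ?_ ?_)
  · rw [abs_mul, abs_mul, abs_of_nonneg (h0 x), abs_of_nonneg (Nat.cast_nonneg _), mul_assoc]
    have h2 := (hB x).trans (le_abs_self B)
    rw [Real.norm_eq_abs] at h2
    refine mul_le_mul_of_nonneg_left ?_ (Nat.cast_nonneg _)
    calc _ ≤ 1 * |B| := mul_le_mul (h1 x) h2 (abs_nonneg _) zero_le_one
      _ = |B| := one_mul _
  · rw [abs_of_nonneg (by positivity)]
    have := hA' x
    gcongr

theorem exists_sum_pderiv_pow_sq_le {ζ : EuclideanSpace ℝ (Fin N) → ℝ} (hζ : ContDiff ℝ 1 ζ)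
    (hs : HasCompactSupport ζ) (n : ℕ) :
    ∃ A > 0, ∀ x, ∑ i, pderiv i (fun x => ζ x ^ (n + 1)) x ^ 2 ≤ A * (ζ x ^ n) ^ 2 := by
  obtain ⟨A, hA, hA'⟩ := exists_sum_pderiv_sq_le hζ hs
  refine ⟨(n + 1 : ℕ) ^ 2 * A, by positivity, fun x => ?_⟩
  have e : ∀ i, pderiv i (fun x => ζ x ^ (n + 1)) x ^ 2
      = ((n + 1 : ℕ) ^ 2 * (ζ x ^ n) ^ 2) * pderiv i ζ x ^ 2 := by
    intro i
    rw [pderiv_pow i (hζ.differentiable (by norm_num) x)]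
    simp only [Nat.add_sub_cancel]
    ring
  simp only [e, ← Finset.mul_sum]
  calc _ ≤ ((n + 1 : ℕ) ^ 2 * (ζ x ^ n) ^ 2) * A :=
        mul_le_mul_of_nonneg_left (hA' x) (by positivity)
    _ = _ := by ring

theorem integral_le_mul_pow {H : EuclideanSpace ℝ (Fin N) → ℝ} (hH : Integrable H) {C r : ℝ}
    (hr : 0 ≤ r) (hC : ∀ x, H x ≤ C) (h0 : ∀ x, r < ‖x‖ → H x = 0) :
    ∫ x, H x ≤
      C * (volume.real (Metric.ball (0 : EuclideanSpace ℝ (Fin N)) 1) * r ^ N) := by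
  have hle : ∀ x, H x ≤ (Metric.closedBall 0 r).indicator (fun _ => C) x := by
    intro x
    by_cases hx : x ∈ Metric.closedBall (0 : EuclideanSpace ℝ (Fin N)) r
    · simpa [Set.indicator_of_mem hx] using hC x
    · rw [Set.indicator_of_notMem hx, h0 x (by simpa [dist_zero_right] using hx)]
  have hi : Integrable ((Metric.closedBall (0 : EuclideanSpace ℝ (Fin N)) r).indicator
      fun _ => C) volume := by
    rw [integrable_indicator_iff measurableSet_closedBall]
    exact integrableOn_const (isCompact_closedBall _ _).measure_lt_top.ne
  refine (integral_mono hH hi hle).trans (le_of_eq ?_)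
  rw [integral_indicator_const _ measurableSet_closedBall, smul_eq_mul, mul_comm,
    Measure.addHaar_real_closedBall _ _ hr, finrank_euclideanSpace_fin, mul_comm (r ^ N)]

theorem eq_zero_of_integral_cutoff_le {g : EuclideanSpace ℝ (Fin N) → ℝ} (hg : Continuous g)
    (hnn : ∀ x, 0 ≤ g x) {ψ : ℝ → EuclideanSpace ℝ (Fin N) → ℝ} {ε : ℝ → ℝ} {R₀ : ℝ}
    (hψi : ∀ R, R₀ ≤ R → Integrable fun x => g x * ψ R x) (hψ0 : ∀ R x, R₀ ≤ R → 0 ≤ ψ R x)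
    (hψ1 : ∀ R x, R₀ ≤ R → ‖x‖ ≤ R → ψ R x = 1)
    (hε : Tendsto ε atTop (𝓝 0)) (hle : ∀ R, R₀ ≤ R → ∫ x, g x * ψ R x ≤ ε R)
    (x : EuclideanSpace ℝ (Fin N)) : g x = 0 := by
  by_contra hx
  obtain ⟨ζ, h1, h2, h3, h4, h5⟩ := exists_cutoff_ball N (‖x‖ + 1) (‖x‖ + 2) (by positivity)
    (by linarith)
  have hs : HasCompactSupport fun y => g y * ζ y :=
    hasCompactSupport_of_le_norm (r := ‖x‖ + 2) fun y hy => by simp [h5 y hy.le]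
  have hc : Continuous fun y => g y * ζ y := hg.mul h1.continuous
  have hpos : 0 < ∫ y, g y * ζ y :=
    hc.integral_pos_of_hasCompactSupport_nonneg_nonzero hs
      (fun y => mul_nonneg (hnn y) (h2 y)) (x := x) (by simp [h4 x (by linarith), hx])
  refine absurd (ge_of_tendsto hε ?_) (not_le.2 hpos)
  filter_upwards [eventually_ge_atTop (‖x‖ + 2), eventually_ge_atTop R₀] with R hR hR₀
  refine le_trans (integral_mono (hc.integrable_of_hasCompactSupport hs) (hψi R hR₀)
    fun y => ?_) (hle R hR₀)
  refine mul_le_mul_of_nonneg_left ?_ (hnn y)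
  rcases le_total ‖y‖ (‖x‖ + 2) with hy | hy
  · rw [hψ1 R y hR₀ (hy.trans hR)]; exact h3 y
  · rw [h5 y hy]; exact hψ0 R y hR₀

end cutoff

theorem exists_young {p c : ℝ} (hp : 1 < p) (hc : 0 < c) :
    ∃ C > 0, ∀ a b : ℝ, 0 ≤ a → 0 ≤ b → a * b ≤ c * a ^ p + C * b ^ (p / (p - 1)) := by
  have hpq : p.HolderConjugate (p / (p - 1)) := Real.HolderConjugate.conjExponent hp
  set l := (c * p) ^ (1 / p) with hl
  have hp0 : 0 < p := by linarith
  have hl0 : 0 < l := Real.rpow_pos_of_pos (by positivity) _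
  have hlp : l ^ p = c * p := by
    rw [hl, ← Real.rpow_mul (by positivity), one_div_mul_cancel hp0.ne', Real.rpow_one]
  have hq0 : 0 < p / (p - 1) := hpq.symm.pos
  refine ⟨l⁻¹ ^ (p / (p - 1)) / (p / (p - 1)), by positivity, fun a b ha hb => ?_⟩
  have h := Real.young_inequality_of_nonneg (mul_nonneg hl0.le ha)
    (mul_nonneg (inv_nonneg.2 hl0.le) hb) hpq
  rw [Real.mul_rpow hl0.le ha, Real.mul_rpow (inv_nonneg.2 hl0.le) hb, hlp] at h
  calc a * b = l * a * (l⁻¹ * b) := by field_simp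
    _ ≤ _ := h
    _ = _ := by field_simp

theorem tendsto_pow_mul_rpow (N : ℕ) {q : ℝ} (hq : (N : ℝ) < 2 * q) (B : ℝ) :
    Tendsto (fun R : ℝ => B * (R ^ N * ((R ^ 2)⁻¹) ^ q)) atTop (𝓝 0) := by
  have h : Tendsto (fun R : ℝ => R ^ (-(2 * q - N))) atTop (𝓝 0) :=
    tendsto_rpow_neg_atTop (by linarith)
  have h2 := h.const_mul B
  rw [mul_zero] at h2
  refine h2.congr' ?_
  filter_upwards [eventually_gt_atTop 0] with R hR
  rw [← Real.rpow_natCast R 2, ← Real.rpow_neg hR.le, ← Real.rpow_mul hR.le,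
    ← Real.rpow_natCast R N, ← Real.rpow_add hR]
  congr 2
  push_cast; ring

section identities
variable {N : ℕ} {u w : EuclideanSpace ℝ (Fin N) → ℝ}

theorem continuous_of_neg_laplacian (hu : ContDiff ℝ 2 u)
    (hΔ : ∀ x, ∑ i, pderiv i (pderiv i u) x = -w x) : Continuous w := by
  have h : Continuous fun x => -∑ i, pderiv i (pderiv i u) x :=
    (continuous_finsetSum _ fun i _ =>
      continuous_pderiv i (contDiff_pderiv (m := 1) i hu (by norm_num))).neg
  simpa only [hΔ, neg_neg] using h

theorem integral_mul_eq_neg_integral_mul_laplacian (hu : ContDiff ℝ 2 u)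
    (hΔ : ∀ x, ∑ i, pderiv i (pderiv i u) x = -w x) {ψ : EuclideanSpace ℝ (Fin N) → ℝ}
    (hψ : ContDiff ℝ 2 ψ) (hs : HasCompactSupport ψ) :
    ∫ x, w x * ψ x = -∫ x, u x * ∑ i, pderiv i (pderiv i ψ) x := by
  have hu1 : ∀ i, ContDiff ℝ 1 (pderiv i u) := fun i => contDiff_pderiv i hu (by norm_num)
  have hψ1 : ∀ i, ContDiff ℝ 1 (pderiv i ψ) := fun i => contDiff_pderiv i hψ (by norm_num)
  have hw := continuous_of_neg_laplacian hu hΔ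
  have hdu : Differentiable ℝ u := hu.differentiable (by norm_num)
  have hdψ : Differentiable ℝ ψ := hψ.differentiable (by norm_num)
  have h := integral_divergence_eq_zero
    (W := fun i x => ψ x * pderiv i u x - u x * pderiv i ψ x)
    (fun i => ((hψ.of_le (by norm_num)).mul (hu1 i)).sub ((hu.of_le (by norm_num)).mul (hψ1 i)))
    (fun i => (hs.mul_right (f' := pderiv i u)).sub ((hs.pderiv i).mul_left (f := u)))
  have e : ∀ x, ∑ i, pderiv i (fun x => ψ x * pderiv i u x - u x * pderiv i ψ x) x
      = -(w x * ψ x) - u x * ∑ i, pderiv i (pderiv i ψ) x := by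
    intro x
    have : ∀ i, pderiv i (fun x => ψ x * pderiv i u x - u x * pderiv i ψ x) x
        = ψ x * pderiv i (pderiv i u) x - u x * pderiv i (pderiv i ψ) x := by
      intro i
      have d1 := (hu1 i).differentiable (by norm_num) x
      have d2 := (hψ1 i).differentiable (by norm_num) x
      rw [pderiv_sub i ((hdψ x).fun_mul d1) ((hdu x).fun_mul d2), pderiv_mul i (hdψ x) d1,
        pderiv_mul i (hdu x) d2]
      ring
    simp only [this, Finset.sum_sub_distrib, ← Finset.mul_sum, hΔ]
    ring
  simp only [e] at h
  rw [integral_sub, integral_neg] at h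
  · linarith
  · exact ((hw.mul hψ.continuous).integrable_of_hasCompactSupport (hs.mul_left (f := w))).neg
  · refine Continuous.integrable_of_hasCompactSupport ?_ ?_
    · exact hu.continuous.mul (continuous_finsetSum _ fun i _ => continuous_pderiv i (hψ1 i))
    · exact (hasCompactSupport_sum fun i => (hs.pderiv i).pderiv i).mul_left

theorem integrable_mul_sum_pderiv_sq {v η : EuclideanSpace ℝ (Fin N) → ℝ} (hv : Continuous v)
    (hη : ContDiff ℝ 1 η) (hs : HasCompactSupport η) :
    Integrable fun x => v x * ∑ i, pderiv i η x ^ 2 := by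
  refine Continuous.integrable_of_hasCompactSupport ?_ ?_
  · exact hv.mul (continuous_finsetSum _ fun i _ => (continuous_pderiv i hη).pow 2)
  · exact (hasCompactSupport_sum fun i =>
      (hs.pderiv i).fun_sq).mul_left

theorem integrable_mul_sq {v η : EuclideanSpace ℝ (Fin N) → ℝ} (hv : Continuous v)
    (hη : Continuous η) (hs : HasCompactSupport η) : Integrable fun x => v x * η x ^ 2 :=
  (hv.mul (hη.pow 2)).integrable_of_hasCompactSupport
    (hs.fun_sq.mul_left)

/-- Testing `-Δu = w` against `u η²`. -/
theorem integral_energy_eq_zero (hu : ContDiff ℝ 2 u)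
    (hΔ : ∀ x, ∑ i, pderiv i (pderiv i u) x = -w x) {η : EuclideanSpace ℝ (Fin N) → ℝ}
    (hη : ContDiff ℝ 1 η) (hs : HasCompactSupport η) :
    ∫ x, (∑ i, pderiv i (fun x => u x * η x) x ^ 2 - u x ^ 2 * ∑ i, pderiv i η x ^ 2
      - u x * w x * η x ^ 2) = 0 := by
  have hu1 : ∀ i, ContDiff ℝ 1 (pderiv i u) := fun i => contDiff_pderiv i hu (by norm_num)
  have hdu : Differentiable ℝ u := hu.differentiable (by norm_num)
  have hdη : Differentiable ℝ η := hη.differentiable (by norm_num)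
  have h := integral_divergence_eq_zero
    (W := fun i x => u x * η x ^ 2 * pderiv i u x)
    (fun i => (((hu.of_le (by norm_num)).mul (hη.pow 2)).mul (hu1 i)))
    (fun i => (hs.fun_sq.mul_left (f := u)).mul_right)
  rw [← h]
  refine integral_congr_ae (ae_of_all _ fun x => ?_)
  simp only
  have e1 : ∀ i, pderiv i (fun x => u x * η x ^ 2 * pderiv i u x) x
      = pderiv i (fun x => u x * η x) x ^ 2 - u x ^ 2 * pderiv i η x ^ 2
        + u x * η x ^ 2 * pderiv i (pderiv i u) x := by
    intro i
    have d1 := (hu1 i).differentiable (by norm_num) x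
    have d2 : DifferentiableAt ℝ (fun x => η x ^ 2) x := (hdη x).pow 2
    rw [pderiv_mul i ((hdu x).fun_mul d2) d1, pderiv_mul i (hdu x) d2, pderiv_pow i (hdη x),
      pderiv_mul i (hdu x) (hdη x)]
    push_cast
    ring
  simp only [e1, Finset.sum_add_distrib, Finset.sum_sub_distrib, ← Finset.mul_sum, hΔ]
  ring

theorem integral_sum_pderiv_mul_sq (hu : ContDiff ℝ 2 u)
    (hΔ : ∀ x, ∑ i, pderiv i (pderiv i u) x = -w x) {η : EuclideanSpace ℝ (Fin N) → ℝ}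
    (hη : ContDiff ℝ 1 η) (hs : HasCompactSupport η) :
    ∫ x, ∑ i, pderiv i (fun x => u x * η x) x ^ 2
      = (∫ x, u x ^ 2 * ∑ i, pderiv i η x ^ 2) + ∫ x, u x * w x * η x ^ 2 := by
  have hw := continuous_of_neg_laplacian hu hΔ
  have h := integral_energy_eq_zero hu hΔ hη hs
  have i1 := integrable_mul_sum_pderiv_sq (v := fun _ => 1) continuous_const
    ((hu.of_le (by norm_num)).mul hη) (hs.mul_left (f := u))
  have i2 := integrable_mul_sum_pderiv_sq (v := fun x => u x ^ 2) (hu.continuous.pow 2) hη hs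
  have i3 := integrable_mul_sq (v := fun x => u x * w x) (hu.continuous.mul hw) hη.continuous hs
  simp only [one_mul] at i1
  rw [integral_sub (by exact i1.sub i2) i3, integral_sub i1 i2] at h
  linarith

/-- Caccioppoli inequality. -/
theorem integral_gradient_sq_mul_le (hu : ContDiff ℝ 2 u)
    (hΔ : ∀ x, ∑ i, pderiv i (pderiv i u) x = -w x) {η : EuclideanSpace ℝ (Fin N) → ℝ}
    (hη : ContDiff ℝ 1 η) (hs : HasCompactSupport η) :
    ∫ x, (∑ i, pderiv i u x ^ 2) * η x ^ 2
      ≤ 2 * (∫ x, u x * w x * η x ^ 2) + 4 * ∫ x, u x ^ 2 * ∑ i, pderiv i η x ^ 2 := by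
  have hw := continuous_of_neg_laplacian hu hΔ
  have hdu : Differentiable ℝ u := hu.differentiable (by norm_num)
  have hdη : Differentiable ℝ η := hη.differentiable (by norm_num)
  have h := integral_sum_pderiv_mul_sq hu hΔ hη hs
  have i1 := integrable_mul_sum_pderiv_sq (v := fun _ => 1) continuous_const
    ((hu.of_le (by norm_num)).mul hη) (hs.mul_left (f := u))
  have i2 := integrable_mul_sum_pderiv_sq (v := fun x => u x ^ 2) (hu.continuous.pow 2) hη hs
  have i4 := integrable_mul_sq (v := fun x => ∑ i, pderiv i u x ^ 2)
    (continuous_finsetSum _ fun i _ => (continuous_pderiv i (hu.of_le (by norm_num))).pow 2)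
    hη.continuous hs
  simp only [one_mul] at i1
  have hle : ∫ x, (∑ i, pderiv i u x ^ 2) * η x ^ 2 ≤
      ∫ x, (2 * ∑ i, pderiv i (fun x => u x * η x) x ^ 2
        + 2 * (u x ^ 2 * ∑ i, pderiv i η x ^ 2)) := by
    refine integral_mono i4 ((i1.const_mul 2).add (i2.const_mul 2)) fun x => ?_
    simp only [Finset.mul_sum, Finset.sum_mul, ← Finset.sum_add_distrib]
    refine Finset.sum_le_sum fun i _ => ?_
    rw [pderiv_mul i (hdu x) (hdη x)]
    nlinarith [sq_nonneg (2 * (u x * pderiv i η x) + pderiv i u x * η x)]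
  rw [integral_add (i1.const_mul 2) (i2.const_mul 2), integral_const_mul, integral_const_mul] at hle
  linarith

/-- The Pohozaev vector field of `u`, with `G` a primitive of the nonlinearity along `u`. -/
noncomputable def pohozaevField (u G : EuclideanSpace ℝ (Fin N) → ℝ) (κ : ℝ) (i : Fin N)
    (x : EuclideanSpace ℝ (Fin N)) : ℝ :=
  (∑ j, x j * pderiv j u x) * pderiv i u x - 1 / 2 * (∑ j, pderiv j u x ^ 2) * x i + G x * x i
    + κ * (u x * pderiv i u x)

theorem contDiff_coord (i : Fin N) : ContDiff ℝ 2 fun x : EuclideanSpace ℝ (Fin N) => x i :=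
  (EuclideanSpace.proj i : EuclideanSpace ℝ (Fin N) →L[ℝ] ℝ).contDiff

theorem contDiff_pohozaevField (hu : ContDiff ℝ 2 u) {G : EuclideanSpace ℝ (Fin N) → ℝ}
    (hG : ContDiff ℝ 1 G) (κ : ℝ) (i : Fin N) : ContDiff ℝ 1 (pohozaevField u G κ i) := by
  have hu1 : ∀ i, ContDiff ℝ 1 (pderiv i u) := fun i => contDiff_pderiv i hu (by norm_num)
  have hx : ∀ i : Fin N, ContDiff ℝ 1 fun x : EuclideanSpace ℝ (Fin N) => x i :=
    fun i => (contDiff_coord i).of_le (by norm_num)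
  have hu' : ContDiff ℝ 1 u := hu.of_le (by norm_num)
  exact (((ContDiff.sum fun j _ => (hx j).mul (hu1 j)).mul (hu1 i)).sub
    ((contDiff_const.mul (ContDiff.sum fun j _ => (hu1 j).pow 2)).mul (hx i))).add
      (hG.mul (hx i)) |>.add (contDiff_const.mul (hu'.mul (hu1 i)))

theorem pderiv_pohozaevField (hu : ContDiff ℝ 2 u) {G : EuclideanSpace ℝ (Fin N) → ℝ}
    (hG : ContDiff ℝ 1 G) (hGi : ∀ i x, pderiv i G x = w x * pderiv i u x) (κ : ℝ) (i : Fin N)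
    (x : EuclideanSpace ℝ (Fin N)) :
    pderiv i (pohozaevField u G κ i) x =
      (pderiv i u x ^ 2 + ∑ j, x j * pderiv j (pderiv i u) x * pderiv i u x)
      + (∑ j, x j * pderiv j u x) * pderiv i (pderiv i u) x
      - ((∑ j, x i * pderiv i (pderiv j u) x * pderiv j u x)
        + 1 / 2 * (∑ j, pderiv j u x ^ 2))
      + (w x * (x i * pderiv i u x) + G x)
      + κ * (pderiv i u x ^ 2 + u x * pderiv i (pderiv i u) x) := by
  have hu1 : ∀ i, DifferentiableAt ℝ (pderiv i u) x := fun i =>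
    (contDiff_pderiv (m := 1) i hu (by norm_num)).differentiable (by norm_num) x
  have hx : ∀ i : Fin N, DifferentiableAt ℝ (fun x : EuclideanSpace ℝ (Fin N) => x i) x :=
    fun i => (contDiff_coord i).differentiable (by norm_num) x
  have hdu : DifferentiableAt ℝ u x := hu.differentiable (by norm_num) x
  have hdG : DifferentiableAt ℝ G x := hG.differentiable (by norm_num) x
  have dX : DifferentiableAt ℝ (fun x => ∑ j, x j * pderiv j u x) x :=
    DifferentiableAt.fun_sum fun j _ => (hx j).fun_mul (hu1 j)
  have dP : DifferentiableAt ℝ (fun x => ∑ j, pderiv j u x ^ 2) x :=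
    DifferentiableAt.fun_sum fun j _ => (hu1 j).fun_pow 2
  have dP' : DifferentiableAt ℝ (fun x => 1 / 2 * ∑ j, pderiv j u x ^ 2) x := dP.const_mul _
  have eX : pderiv i (fun x => ∑ j, x j * pderiv j u x) x
      = pderiv i u x + ∑ j, x j * pderiv j (pderiv i u) x := by
    rw [pderiv_sum _ _ fun j _ => (hx j).fun_mul (hu1 j)]
    have : ∀ j, pderiv i (fun x => x j * pderiv j u x) x
        = x j * pderiv j (pderiv i u) x + (if j = i then 1 else 0) * pderiv j u x := by
      intro j
      rw [pderiv_mul i (hx j) (hu1 j), pderiv_coord, pderiv_comm i j hu]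
    simp only [this, Finset.sum_add_distrib, ite_mul, one_mul, zero_mul, Finset.sum_ite_eq',
      Finset.mem_univ, if_true]
    ring
  have eP : pderiv i (fun x => ∑ j, pderiv j u x ^ 2) x
      = 2 * ∑ j, pderiv i (pderiv j u) x * pderiv j u x := by
    rw [pderiv_sum _ _ fun j _ => (hu1 j).fun_pow 2, Finset.mul_sum]
    refine Finset.sum_congr rfl fun j _ => ?_
    rw [pderiv_pow i (hu1 j)]
    push_cast
    ring
  change pderiv i (fun x => (∑ j, x j * pderiv j u x) * pderiv i u x
    - 1 / 2 * (∑ j, pderiv j u x ^ 2) * x i + G x * x i + κ * (u x * pderiv i u x)) x = _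
  rw [pderiv_add i (((dX.fun_mul (hu1 i)).fun_sub (dP'.fun_mul (hx i))).fun_add (hdG.fun_mul (hx i)))
      ((hdu.fun_mul (hu1 i)).const_mul κ),
    pderiv_add i ((dX.fun_mul (hu1 i)).fun_sub (dP'.fun_mul (hx i))) (hdG.fun_mul (hx i)),
    pderiv_sub i (dX.fun_mul (hu1 i)) (dP'.fun_mul (hx i)), pderiv_mul i dX (hu1 i),
    pderiv_mul i dP' (hx i), pderiv_const_mul, pderiv_const_mul, pderiv_mul i hdG (hx i),
    pderiv_mul i hdu (hu1 i), eX, eP, hGi, pderiv_coord]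
  simp only [if_true]
  have s1 : (∑ j, x j * pderiv j (pderiv i u) x * pderiv i u x)
      = (∑ j, x j * pderiv j (pderiv i u) x) * pderiv i u x := by rw [Finset.sum_mul]
  have s2 : (∑ j, x i * pderiv i (pderiv j u) x * pderiv j u x)
      = x i * ∑ j, pderiv i (pderiv j u) x * pderiv j u x := by
    rw [Finset.mul_sum]; exact Finset.sum_congr rfl fun j _ => by ring
  rw [s1, s2]
  ring

theorem sum_pderiv_pohozaevField (hu : ContDiff ℝ 2 u)
    (hΔ : ∀ x, ∑ i, pderiv i (pderiv i u) x = -w x) {G : EuclideanSpace ℝ (Fin N) → ℝ}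
    (hG : ContDiff ℝ 1 G) (hGi : ∀ i x, pderiv i G x = w x * pderiv i u x)
    (x : EuclideanSpace ℝ (Fin N)) :
    ∑ i, pderiv i (pohozaevField u G ((N : ℝ) / 2 - 1) i) x
      = N * G x - ((N : ℝ) / 2 - 1) * (u x * w x) := by
  simp only [pderiv_pohozaevField hu hG hGi, Finset.sum_add_distrib, Finset.sum_sub_distrib,
    ← Finset.mul_sum, hΔ, Finset.sum_const, Finset.card_univ, Fintype.card_fin, nsmul_eq_mul]
  rw [Finset.sum_comm (f := fun i j => x j * pderiv j (pderiv i u) x * pderiv i u x)]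
  ring

theorem integral_pohozaev (hu : ContDiff ℝ 2 u)
    (hΔ : ∀ x, ∑ i, pderiv i (pderiv i u) x = -w x) {G : EuclideanSpace ℝ (Fin N) → ℝ}
    (hG : ContDiff ℝ 1 G) (hGi : ∀ i x, pderiv i G x = w x * pderiv i u x)
    {χ : EuclideanSpace ℝ (Fin N) → ℝ} (hχ : ContDiff ℝ 1 χ) (hs : HasCompactSupport χ) :
    ∫ x, (N * G x - ((N : ℝ) / 2 - 1) * (u x * w x)) * χ x
      = -∫ x, ∑ i, pderiv i χ x * pohozaevField u G ((N : ℝ) / 2 - 1) i x := by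
  set κ := (N : ℝ) / 2 - 1 with hκ
  have hw := continuous_of_neg_laplacian hu hΔ
  have hV := fun i => contDiff_pohozaevField hu hG κ i
  have h := integral_divergence_eq_zero (W := fun i x => χ x * pohozaevField u G κ i x)
    (fun i => hχ.mul (hV i)) (fun i => hs.mul_right)
  have e : ∀ x, ∑ i, pderiv i (fun x => χ x * pohozaevField u G κ i x) x
      = (N * G x - κ * (u x * w x)) * χ x + ∑ i, pderiv i χ x * pohozaevField u G κ i x := by
    intro x
    rw [← sum_pderiv_pohozaevField hu hΔ hG hGi, Finset.sum_mul, ← Finset.sum_add_distrib]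
    refine Finset.sum_congr rfl fun i _ => ?_
    rw [pderiv_mul i (hχ.differentiable (by norm_num) x)
      ((hV i).differentiable (by norm_num) x)]
    ring
  simp only [e] at h
  rw [integral_add] at h
  · linarith
  · exact (((continuous_const.mul hG.continuous).sub (continuous_const.mul
      (hu.continuous.mul hw))).mul hχ.continuous).integrable_of_hasCompactSupport hs.mul_left
  · exact (continuous_finsetSum _ fun i _ => (continuous_pderiv i hχ).mul
      (hV i).continuous).integrable_of_hasCompactSupport
        (hasCompactSupport_sum fun i => (hs.pderiv i).mul_right)

end identities

section liouville
variable {N : ℕ} {u w : EuclideanSpace ℝ (Fin N) → ℝ}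

theorem exists_nat_add_two_le_mul {p : ℝ} (hp : 1 < p) : ∃ n : ℕ, ((n + 2 : ℕ) : ℝ) ≤ n * p := by
  obtain ⟨n, hn⟩ := exists_nat_ge (2 / (p - 1))
  refine ⟨n, ?_⟩
  rw [div_le_iff₀ (by linarith)] at hn
  push_cast
  linarith

theorem mul_pow_rpow_le {a z p : ℝ} {n m : ℕ} (ha : 0 ≤ a) (hz : 0 ≤ z) (hz1 : z ≤ 1)
    (hm : 0 < m) (hn : (m : ℝ) ≤ n * p) : (a * z ^ n) ^ p ≤ a ^ p * z ^ m := by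
  rw [Real.mul_rpow ha (pow_nonneg hz n), ← Real.rpow_natCast_mul hz, ← Real.rpow_natCast z m]
  refine mul_le_mul_of_nonneg_left ?_ (Real.rpow_nonneg ha p)
  rcases hz.eq_or_lt with rfl | h0
  · have : (0 : ℝ) < m := by exact_mod_cast hm
    rw [Real.zero_rpow (by linarith : (0 : ℝ) < n * p).ne', Real.zero_rpow this.ne']
  · exact Real.rpow_le_rpow_of_exponent_ge h0 hz1 hn

theorem laplacian_comp_smul {ψ : EuclideanSpace ℝ (Fin N) → ℝ} (hψ : ContDiff ℝ 2 ψ) (c : ℝ)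
    (x : EuclideanSpace ℝ (Fin N)) :
    ∑ i, pderiv i (pderiv i fun x => ψ (c • x)) x
      = c ^ 2 * ∑ i, pderiv i (pderiv i ψ) (c • x) := by
  rw [Finset.mul_sum]
  refine Finset.sum_congr rfl fun i _ => ?_
  have e : (pderiv i fun x => ψ (c • x)) = fun x => c * pderiv i ψ (c • x) :=
    funext fun y => pderiv_comp_smul i c (hψ.differentiable (by norm_num)) y
  rw [e, pderiv_const_mul, pderiv_comp_smul i c
    ((contDiff_pderiv (m := 1) i hψ (by norm_num)).differentiable (by norm_num))]
  ring

theorem contDiff_comp_smul {ψ : EuclideanSpace ℝ (Fin N) → ℝ} {n : WithTop ℕ∞}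
    (hψ : ContDiff ℝ n ψ) (c : ℝ) : ContDiff ℝ n fun x => ψ (c • x) :=
  hψ.comp (contDiff_const_smul c)

theorem norm_inv_smul {R : ℝ} (hR : 0 < R) (x : EuclideanSpace ℝ (Fin N)) :
    ‖R⁻¹ • x‖ = ‖x‖ / R := by
  rw [norm_smul, norm_inv, Real.norm_of_nonneg hR.le, div_eq_inv_mul]

/-- Liouville theorem for supersolutions of `-Δu = c u^p`, by testing against powers of
cutoffs. -/
theorem eq_zero_of_rpow_le (hu : ContDiff ℝ 2 u)
    (hΔ : ∀ x, ∑ i, pderiv i (pderiv i u) x = -w x) (hu0 : ∀ x, 0 ≤ u x) (hw0 : ∀ x, 0 ≤ w x)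
    {p c : ℝ} (hp : 1 < p) (hc : 0 < c) (hcw : ∀ x, c * u x ^ p ≤ w x)
    (hN : (N : ℝ) < 2 * (p / (p - 1))) (x : EuclideanSpace ℝ (Fin N)) : u x = 0 := by
  have hw := continuous_of_neg_laplacian hu hΔ
  suffices h : w x = 0 by
    have h1 := hcw x
    rw [h] at h1
    by_contra hne
    have := Real.rpow_pos_of_pos ((hu0 x).lt_of_ne' hne) p
    nlinarith
  obtain ⟨ζ, hζ, hζ0, hζ1, hζa, hζb⟩ := exists_cutoff_ball N 1 2 one_pos one_lt_two
  have hζs : HasCompactSupport ζ := hasCompactSupport_of_le_norm fun x hx => hζb x hx.le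
  obtain ⟨n, hn⟩ := exists_nat_add_two_le_mul hp
  obtain ⟨A, hA, hA'⟩ := exists_abs_laplacian_pow_le hζ hζs hζ0 hζ1 n
  obtain ⟨C, hC, hC'⟩ := exists_young hp (show 0 < c / (2 * A) by positivity)
  set q := p / (p - 1)
  set ω := volume.real (Metric.ball (0 : EuclideanSpace ℝ (Fin N)) 1)
  set ψ : ℝ → EuclideanSpace ℝ (Fin N) → ℝ := fun R x => ζ (R⁻¹ • x) ^ (n + 2) with hψ
  have hψ2 : ∀ R, ContDiff ℝ 2 (ψ R) := fun R => contDiff_comp_smul (hζ.pow (n + 2)) R⁻¹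
  have hζR : ∀ R : ℝ, 1 ≤ R → ∀ x, 2 * R < ‖x‖ → ζ (R⁻¹ • x) = 0 := fun R hR x hx => by
    refine hζb _ ?_
    rw [norm_inv_smul (by linarith), le_div_iff₀ (by linarith)]
    exact hx.le
  have hψs : ∀ R, 1 ≤ R → HasCompactSupport (ψ R) := fun R hR =>
    hasCompactSupport_of_le_norm (r := 2 * R) fun x hx => by simp [hψ, hζR R hR x hx]
  have hlap : ∀ R x, |∑ i, pderiv i (pderiv i (ψ R)) x| ≤ (R ^ 2)⁻¹ * (A * ζ (R⁻¹ • x) ^ n) := by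
    intro R x
    have := laplacian_comp_smul (hζ.pow (n + 2)) R⁻¹ x
    rw [hψ, this, abs_mul, abs_of_nonneg (by positivity), inv_pow]
    exact mul_le_mul_of_nonneg_left (hA' _) (by positivity)
  refine eq_zero_of_integral_cutoff_le (R₀ := 1) (ψ := ψ) hw hw0
    (fun R hR => (hw.mul (hψ2 R).continuous).integrable_of_hasCompactSupport (hψs R hR).mul_left)
    (fun R x _ => pow_nonneg (hζ0 _) _) (fun R x hR hx => ?_)
    (tendsto_pow_mul_rpow N hN (2 * (A * C * (ω * 2 ^ N)))) (fun R hR => ?_) x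
  · have : ζ (R⁻¹ • x) = 1 := hζa _ (by
      rw [norm_inv_smul (by linarith), div_le_one (by linarith)]; exact hx)
    simp [hψ, this]
  have iwψ : Integrable fun x => w x * ψ R x :=
    (hw.mul (hψ2 R).continuous).integrable_of_hasCompactSupport (hψs R hR).mul_left
  have iuψ : Integrable fun x => u x * ∑ i, pderiv i (pderiv i (ψ R)) x := by
    refine Continuous.integrable_of_hasCompactSupport ?_ ?_
    · exact hu.continuous.mul (continuous_finsetSum _ fun i _ =>
        continuous_pderiv i (contDiff_pderiv i (hψ2 R) (by norm_num)))
    · exact (hasCompactSupport_sum fun i => ((hψs R hR).pderiv i).pderiv i).mul_left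
  have h := integral_le_mul_pow (C := A * C * ((R ^ 2)⁻¹) ^ q) (r := 2 * R)
    (iuψ.neg.sub (iwψ.const_mul (1 / 2)))
    (by linarith) (fun x => ?_) (fun x hx => ?_)
  · simp only [Pi.sub_apply, Pi.neg_apply] at h
    rw [integral_sub (by exact iuψ.neg) (iwψ.const_mul _), integral_neg, integral_const_mul,
      ← integral_mul_eq_neg_integral_mul_laplacian hu hΔ (hψ2 R) (hψs R hR), mul_pow] at h
    linarith
  · simp only [Pi.sub_apply, Pi.neg_apply]
    set z := ζ (R⁻¹ • x) with hz
    have h1 : -(u x * ∑ i, pderiv i (pderiv i (ψ R)) x)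
        ≤ u x * ((R ^ 2)⁻¹ * (A * z ^ n)) := by
      rw [← mul_neg]
      exact mul_le_mul_of_nonneg_left ((neg_le_abs _).trans (hlap R x)) (hu0 x)
    have h2 := hC' (u x * z ^ n) ((R ^ 2)⁻¹) (mul_nonneg (hu0 x) (pow_nonneg (hζ0 _) _))
      (by positivity)
    have h3 : (u x * z ^ n) ^ p ≤ u x ^ p * z ^ (n + 2) :=
      mul_pow_rpow_le (hu0 x) (hζ0 _) (hζ1 _) (by omega) hn
    have h4 : c * u x ^ p * z ^ (n + 2) ≤ w x * z ^ (n + 2) :=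
      mul_le_mul_of_nonneg_right (hcw x) (pow_nonneg (hζ0 _) _)
    have h5 : u x * ((R ^ 2)⁻¹ * (A * z ^ n))
        ≤ A * (c / (2 * A) * (u x ^ p * z ^ (n + 2)) + C * ((R ^ 2)⁻¹) ^ q) := by
      calc _ = A * (u x * z ^ n * (R ^ 2)⁻¹) := by ring
        _ ≤ A * (c / (2 * A) * (u x * z ^ n) ^ p + C * ((R ^ 2)⁻¹) ^ q) :=
          mul_le_mul_of_nonneg_left h2 hA.le
        _ ≤ _ := by gcongr
    have h6 : A * (c / (2 * A) * (u x ^ p * z ^ (n + 2)) + C * ((R ^ 2)⁻¹) ^ q)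
        = 1 / 2 * (c * u x ^ p * z ^ (n + 2)) + A * C * ((R ^ 2)⁻¹) ^ q := by
      field_simp
    change _ - 1 / 2 * (w x * z ^ (n + 2)) ≤ _
    linarith
  · have h0 := hζR R hR x hx
    have h1 : ∑ i, pderiv i (pderiv i (ψ R)) x = 0 := by
      have h2 := hlap R x
      rcases n.eq_zero_or_pos with rfl | hn0
      · norm_num at hn
      · rw [h0, zero_pow hn0.ne', mul_zero, mul_zero] at h2
        exact abs_nonpos_iff.1 h2
    simp only [Pi.sub_apply, Pi.neg_apply, h1]
    simp [hψ, h0]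

theorem sum_pderiv_sq_comp_smul {η : EuclideanSpace ℝ (Fin N) → ℝ} (hη : ContDiff ℝ 1 η) (c : ℝ)
    (x : EuclideanSpace ℝ (Fin N)) :
    ∑ i, pderiv i (fun x => η (c • x)) x ^ 2 = c ^ 2 * ∑ i, pderiv i η (c • x) ^ 2 := by
  rw [Finset.mul_sum]
  refine Finset.sum_congr rfl fun i _ => ?_
  rw [pderiv_comp_smul i c (hη.differentiable (by norm_num)), mul_pow]

/-- Energy decay on dyadic annuli for solutions satisfying a reversed Caccioppoli inequality
away from the origin. -/
theorem exists_annulus_energy_le (hu : ContDiff ℝ 2 u)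
    (hΔ : ∀ x, ∑ i, pderiv i (pderiv i u) x = -w x)
    {P c δ R₁ : ℝ} (hP : 1 < P) (hc : 0 < c) (hδ : 0 < δ)
    (hcw : ∀ x, c * (u x ^ 2) ^ P ≤ u x * w x)
    (hstab : ∀ η : EuclideanSpace ℝ (Fin N) → ℝ, ContDiff ℝ 1 η → HasCompactSupport η →
      (∀ x, ‖x‖ < R₁ → η x = 0) →
      δ * ∫ x, u x * w x * η x ^ 2 ≤ ∫ x, u x ^ 2 * ∑ i, pderiv i η x ^ 2) :
    ∃ B, ∀ R, 1 ≤ R → 2 * R₁ ≤ R → ∃ η : EuclideanSpace ℝ (Fin N) → ℝ,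
      ContDiff ℝ 1 η ∧ HasCompactSupport η ∧ (∀ x, R ≤ ‖x‖ → ‖x‖ ≤ 2 * R → η x = 1) ∧
      ∫ x, (∑ i, pderiv i u x ^ 2 + u x * w x + (R ^ 2)⁻¹ * u x ^ 2) * η x ^ 2
        ≤ B * (R ^ N * ((R ^ 2)⁻¹) ^ (P / (P - 1))) := by
  have hw := continuous_of_neg_laplacian hu hΔ
  obtain ⟨α, hα, hα0, hα1, hαa, hαb, hαc⟩ := exists_cutoff_annulus N
  have hα' : ContDiff ℝ 1 α := hα.of_le (by norm_num)
  have hαs : HasCompactSupport α := hasCompactSupport_of_le_norm fun x hx => hαc x hx.le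
  obtain ⟨n, hn⟩ := exists_nat_add_two_le_mul hP
  obtain ⟨A, hA, hA'⟩ := exists_sum_pderiv_pow_sq_le hα' hαs n
  obtain ⟨C, hC, hC'⟩ := exists_young hP (show 0 < c * δ / (2 * A) by positivity)
  set q := P / (P - 1)
  set ω := volume.real (Metric.ball (0 : EuclideanSpace ℝ (Fin N)) 1)
  refine ⟨(6 / δ + 8 + 2 / A) * (A * C * (ω * 3 ^ N)), fun R hR hR₁ => ?_⟩
  have hR0 : 0 < R := by linarith
  set η : EuclideanSpace ℝ (Fin N) → ℝ := fun x => α (R⁻¹ • x) ^ (n + 1) with hη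
  have hη1 : ContDiff ℝ 1 η := contDiff_comp_smul (hα'.pow (n + 1)) R⁻¹
  have hα3 : ∀ x, 3 * R < ‖x‖ → α (R⁻¹ • x) = 0 := fun x hx => hαc _ (by
    rw [norm_inv_smul hR0, le_div_iff₀ hR0]; exact hx.le)
  have hη3 : ∀ x, 3 * R < ‖x‖ → η x = 0 := fun x hx => by simp [hη, hα3 x hx]
  have hηs : HasCompactSupport η := hasCompactSupport_of_le_norm hη3
  have hn0 : n ≠ 0 := by
    rintro rfl
    norm_num at hn
  set S : EuclideanSpace ℝ (Fin N) → ℝ := fun x => ∑ i, pderiv i η x ^ 2 with hS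
  have hSle : ∀ x, S x ≤ A * ((R ^ 2)⁻¹ * α (R⁻¹ • x) ^ (2 * n)) := fun x => by
    have := sum_pderiv_sq_comp_smul (hα'.pow (n + 1)) R⁻¹ x
    rw [hS]
    simp only
    rw [this, inv_pow]
    calc _ ≤ (R ^ 2)⁻¹ * (A * (α (R⁻¹ • x) ^ n) ^ 2) :=
          mul_le_mul_of_nonneg_left (hA' _) (by positivity)
      _ = _ := by rw [← pow_mul]; ring
  have hS3 : ∀ x, 3 * R < ‖x‖ → S x = 0 := fun x hx => by
    refine le_antisymm ((hSle x).trans ?_) (Finset.sum_nonneg fun i _ => sq_nonneg _)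
    simp [hα3 x hx, hn0]
  have hQ : ∀ x, (R ^ 2)⁻¹ * u x ^ 2 * α (R⁻¹ • x) ^ (2 * n)
      ≤ δ / (2 * A) * (u x * w x * η x ^ 2) + C * ((R ^ 2)⁻¹) ^ q := fun x => by
    set z := α (R⁻¹ • x) with hz
    have h1 := hC' (u x ^ 2 * z ^ (2 * n)) ((R ^ 2)⁻¹)
      (mul_nonneg (sq_nonneg _) (pow_nonneg (hα0 _) _)) (by positivity)
    have h2 : (u x ^ 2 * z ^ (2 * n)) ^ P ≤ (u x ^ 2) ^ P * z ^ (2 * (n + 1)) := by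
      refine mul_pow_rpow_le (sq_nonneg _) (hα0 _) (hα1 _) (by omega) ?_
      push_cast at hn ⊢
      linarith
    have h3 : c * (u x ^ 2) ^ P * z ^ (2 * (n + 1)) ≤ u x * w x * z ^ (2 * (n + 1)) :=
      mul_le_mul_of_nonneg_right (hcw x) (pow_nonneg (hα0 _) _)
    have h4 : η x ^ 2 = z ^ (2 * (n + 1)) := by rw [hη, ← pow_mul, mul_comm]
    rw [h4]
    calc _ = u x ^ 2 * z ^ (2 * n) * (R ^ 2)⁻¹ := by ring
      _ ≤ _ := h1
      _ ≤ c * δ / (2 * A) * ((u x ^ 2) ^ P * z ^ (2 * (n + 1))) + C * ((R ^ 2)⁻¹) ^ q := by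
        gcongr
      _ = δ / (2 * A) * (c * (u x ^ 2) ^ P * z ^ (2 * (n + 1))) + C * ((R ^ 2)⁻¹) ^ q := by ring
      _ ≤ _ := by gcongr
  have hint : ∀ {v : EuclideanSpace ℝ (Fin N) → ℝ}, Continuous v →
      Integrable fun x => v x * η x ^ 2 := fun hv => integrable_mul_sq hv hη1.continuous hηs
  have iX := hint (v := fun x => u x * w x) (hu.continuous.mul hw)
  have iZ := hint (v := fun x => (R ^ 2)⁻¹ * u x ^ 2) (continuous_const.mul (hu.continuous.pow 2))
  have iW := hint (v := fun x => ∑ i, pderiv i u x ^ 2) (continuous_finsetSum _ fun i _ =>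
    (continuous_pderiv i (hu.of_le (by norm_num))).pow 2)
  have iY := integrable_mul_sum_pderiv_sq (v := fun x => u x ^ 2) (hu.continuous.pow 2) hη1 hηs
  set ε := A * C * ((R ^ 2)⁻¹) ^ q * (ω * (3 * R) ^ N) with hε
  have hY := integral_le_mul_pow (C := A * C * ((R ^ 2)⁻¹) ^ q) (r := 3 * R)
    (iY.sub (iX.const_mul (δ / 2))) (by linarith) (fun x => ?_) fun x hx => ?_
  · have hZ := integral_le_mul_pow (C := C * ((R ^ 2)⁻¹) ^ q) (r := 3 * R)
      (iZ.sub (iX.const_mul (δ / (2 * A)))) (by linarith) (fun x => ?_) fun x hx => ?_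
    · have hst := hstab η hη1 hηs fun x hx => by
        have : α (R⁻¹ • x) = 0 := hαb _ (by
          rw [norm_inv_smul hR0, div_le_iff₀ hR0]; linarith)
        simp [hη, this]
      have hca := integral_gradient_sq_mul_le hu hΔ hη1 hηs
      simp only [Pi.sub_apply] at hY hZ
      rw [integral_sub iY (iX.const_mul _), integral_const_mul] at hY
      rw [integral_sub iZ (iX.const_mul _), integral_const_mul] at hZ
      refine ⟨η, hη1, hηs, fun x hx hx' => ?_, ?_⟩
      · have : α (R⁻¹ • x) = 1 := hαa _ (by rwa [norm_inv_smul hR0, one_le_div hR0])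
          (by rwa [norm_inv_smul hR0, div_le_iff₀ hR0])
        simp [hη, this]
      have e : (fun x => (∑ i, pderiv i u x ^ 2 + u x * w x + (R ^ 2)⁻¹ * u x ^ 2) * η x ^ 2)
          = fun x => ((∑ i, pderiv i u x ^ 2) * η x ^ 2 + u x * w x * η x ^ 2)
            + (R ^ 2)⁻¹ * u x ^ 2 * η x ^ 2 := funext fun x => by ring
      rw [e, integral_add (by exact iW.add iX) iZ, integral_add iW iX]
      set X := ∫ x, u x * w x * η x ^ 2
      set Y := ∫ x, u x ^ 2 * ∑ i, pderiv i η x ^ 2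
      set Z := ∫ x, (R ^ 2)⁻¹ * u x ^ 2 * η x ^ 2
      have hX : X ≤ 2 * ε / δ := by
        rw [le_div_iff₀ hδ]
        linarith
      have hX' : δ * X ≤ 2 * ε := by linarith
      have hZ' : Z ≤ 2 * ε / A := by
        have h1 : δ / (2 * A) * X ≤ ε / A := by
          rw [div_mul_eq_mul_div, div_le_div_iff₀ (by positivity) hA]
          nlinarith
        have h2 : C * ((R ^ 2)⁻¹) ^ q * (ω * (3 * R) ^ N) = ε / A := by
          rw [hε]; field_simp
        have h3 : 2 * ε / A = ε / A + ε / A := by ring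
        linarith
      have hfin : (6 / δ + 8 + 2 / A) * (A * C * (ω * 3 ^ N)) * (R ^ N * ((R ^ 2)⁻¹) ^ q)
          = 3 * (2 * ε / δ) + 8 * ε + 2 * ε / A := by
        rw [hε, mul_pow]; ring
      rw [hfin]
      linarith
    · simp only [Pi.sub_apply]
      have h1 : (R ^ 2)⁻¹ * u x ^ 2 * η x ^ 2 ≤ (R ^ 2)⁻¹ * u x ^ 2 * α (R⁻¹ • x) ^ (2 * n) := by
        refine mul_le_mul_of_nonneg_left ?_ (by positivity)
        rw [hη, ← pow_mul]
        exact pow_le_pow_of_le_one (hα0 _) (hα1 _) (by linarith)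
      linarith [hQ x]
    · simp [hη3 x hx]
  · simp only [Pi.sub_apply]
    have h1 : u x ^ 2 * S x ≤ A * ((R ^ 2)⁻¹ * u x ^ 2 * α (R⁻¹ • x) ^ (2 * n)) := by
      calc _ ≤ u x ^ 2 * (A * ((R ^ 2)⁻¹ * α (R⁻¹ • x) ^ (2 * n))) :=
            mul_le_mul_of_nonneg_left (hSle x) (sq_nonneg _)
        _ = _ := by ring
    have h2 := mul_le_mul_of_nonneg_left (hQ x) hA.le
    have h3 : A * (δ / (2 * A) * (u x * w x * η x ^ 2) + C * ((R ^ 2)⁻¹) ^ q)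
        = δ / 2 * (u x * w x * η x ^ 2) + A * C * ((R ^ 2)⁻¹) ^ q := by
      field_simp
    change u x ^ 2 * S x - _ ≤ _
    linarith
  · change u x ^ 2 * S x - δ / 2 * (u x * w x * η x ^ 2) = 0
    simp [hS3 x hx, hη3 x hx]

theorem abs_mul_add_mul_le {A R T b d e g v κ : ℝ} (hκ : 0 ≤ κ) (hR : 0 < R) (hA0 : 0 ≤ A)
    (hT0 : 0 ≤ T) (hg : 0 ≤ g) (hb2 : b ^ 2 ≤ 4 * R ^ 2 * T) (hd2 : R ^ 2 * d ^ 2 ≤ A * T)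
    (he2 : e ^ 2 ≤ 4 * A) :
    |b * d - 1 / 2 * T * e + g * e + κ * (v * d)|
      ≤ (3 + 2 * A + κ * (A + 1)) * (T + g + (R ^ 2)⁻¹ * v ^ 2) := by
  have hRi : (R⁻¹) ^ 2 = (R ^ 2)⁻¹ := inv_pow R 2
  have hRR : R⁻¹ * R = 1 := inv_mul_cancel₀ hR.ne'
  have hb3 : (R⁻¹ * b) ^ 2 ≤ 4 * T := by
    rw [mul_pow, hRi, inv_mul_le_iff₀ (by positivity)]
    linarith
  have hd3 : (R * d) ^ 2 ≤ A * T := by rw [mul_pow]; exact hd2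
  have hbd : |b * d| ≤ (4 * T + A * T) / 2 := by
    have : b * d = (R⁻¹ * b) * (R * d) := by linear_combination (-(b * d)) * hRR
    rw [this, abs_le]
    constructor
    · nlinarith [sq_nonneg (R⁻¹ * b + R * d)]
    · nlinarith [sq_nonneg (R⁻¹ * b - R * d)]
  have hud : |v * d| ≤ ((R ^ 2)⁻¹ * v ^ 2 + A * T) / 2 := by
    have : v * d = (R⁻¹ * v) * (R * d) := by linear_combination (-(v * d)) * hRR
    rw [this, ← hRi, ← mul_pow, abs_le]
    constructor
    · nlinarith [sq_nonneg (R⁻¹ * v + R * d)]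
    · nlinarith [sq_nonneg (R⁻¹ * v - R * d)]
  have he3 : |e| ≤ (4 * A + 1) / 2 := by
    rw [abs_le]
    constructor
    · nlinarith [sq_nonneg (e + 1)]
    · nlinarith [sq_nonneg (e - 1)]
  have hV : 0 ≤ (R ^ 2)⁻¹ * v ^ 2 := by positivity
  set V := (R ^ 2)⁻¹ * v ^ 2
  have h1 : |1 / 2 * T * e| ≤ 1 / 2 * T * ((4 * A + 1) / 2) := by
    rw [abs_mul, abs_of_nonneg (by positivity)]
    gcongr
  have h2 : |g * e| ≤ g * ((4 * A + 1) / 2) := by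
    rw [abs_mul, abs_of_nonneg hg]
    gcongr
  have h3 : |κ * (v * d)| ≤ κ * ((V + A * T) / 2) := by
    rw [abs_mul, abs_of_nonneg hκ]
    gcongr
  have h4 : |b * d - 1 / 2 * T * e + g * e + κ * (v * d)|
      ≤ |b * d| + |1 / 2 * T * e| + |g * e| + |κ * (v * d)| :=
    (abs_add_le _ _).trans (add_le_add_left ((abs_add_le _ _).trans
      (add_le_add_left (abs_sub _ _) _)) _)
  have := mul_nonneg hA0 hT0
  have := mul_nonneg hκ (mul_nonneg hA0 hT0)
  have := mul_nonneg hA0 hV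
  have := mul_nonneg hκ (mul_nonneg hA0 hV)
  have := mul_nonneg hκ hV
  have := mul_nonneg hκ hT0
  have := mul_nonneg hκ hg
  have := mul_nonneg hκ (mul_nonneg hA0 hg)
  have := mul_nonneg hA0 hg
  linarith

theorem abs_sum_mul_pohozaevField_le {G : EuclideanSpace ℝ (Fin N) → ℝ} {κ A R : ℝ} (hκ : 0 ≤ κ)
    (hR : 0 < R) (a : Fin N → ℝ) (ha : R ^ 2 * ∑ i, a i ^ 2 ≤ A)
    {x : EuclideanSpace ℝ (Fin N)} (hG : 0 ≤ G x) (hx : ‖x‖ ≤ 2 * R) :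
    |∑ i, a i * pohozaevField u G κ i x|
      ≤ (3 + 2 * A + κ * (A + 1)) * (∑ i, pderiv i u x ^ 2 + G x + (R ^ 2)⁻¹ * u x ^ 2) := by
  set T := ∑ i, pderiv i u x ^ 2 with hT
  have hT0 : 0 ≤ T := Finset.sum_nonneg fun i _ => sq_nonneg _
  have hA0 : 0 ≤ A := le_trans (by positivity) ha
  have hX : ∑ i, x i ^ 2 ≤ 4 * R ^ 2 := by
    have : ‖x‖ ^ 2 ≤ (2 * R) ^ 2 := pow_le_pow_left₀ (norm_nonneg x) hx 2
    rw [EuclideanSpace.norm_sq_eq] at this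
    simp only [Real.norm_eq_abs, sq_abs] at this
    linarith
  set b := ∑ i, x i * pderiv i u x with hb
  set d := ∑ i, a i * pderiv i u x with hd
  set e := ∑ i, a i * x i with he
  have hb2 : b ^ 2 ≤ 4 * R ^ 2 * T :=
    (Finset.sum_mul_sq_le_sq_mul_sq _ _ _).trans (mul_le_mul_of_nonneg_right hX hT0)
  have hd2 : R ^ 2 * d ^ 2 ≤ A * T := by
    have h1 := Finset.sum_mul_sq_le_sq_mul_sq Finset.univ a fun i => pderiv i u x
    calc R ^ 2 * d ^ 2 ≤ R ^ 2 * ((∑ i, a i ^ 2) * T) := by gcongr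
      _ = R ^ 2 * (∑ i, a i ^ 2) * T := by ring
      _ ≤ A * T := by gcongr
  have he2 : e ^ 2 ≤ 4 * A := by
    have h1 := Finset.sum_mul_sq_le_sq_mul_sq Finset.univ a fun i => x i
    calc e ^ 2 ≤ (∑ i, a i ^ 2) * ∑ i, x i ^ 2 := h1
      _ ≤ (∑ i, a i ^ 2) * (4 * R ^ 2) := by gcongr
      _ = 4 * (R ^ 2 * ∑ i, a i ^ 2) := by ring
      _ ≤ 4 * A := by gcongr
  have hsum : ∑ i, a i * pohozaevField u G κ i x = b * d - 1 / 2 * T * e + G x * e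
      + κ * (u x * d) := by
    simp only [hb, hd, he, Finset.mul_sum, ← Finset.sum_add_distrib, ← Finset.sum_sub_distrib]
    refine Finset.sum_congr rfl fun i _ => ?_
    rw [pohozaevField]
    ring
  rw [hsum]
  exact abs_mul_add_mul_le hκ hR hA0 hT0 hG hb2 hd2 he2

theorem pderiv_eq_zero_of_eventuallyEq {g : EuclideanSpace ℝ (Fin N) → ℝ}
    {x : EuclideanSpace ℝ (Fin N)} {c : ℝ} (h : g =ᶠ[𝓝 x] fun _ => c) (i : Fin N) :
    pderiv i g x = 0 := by
  rw [pderiv, h.fderiv_eq]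
  simp

/-- Liouville theorem by the Pohozaev identity, for solutions satisfying a reversed Caccioppoli
inequality away from the origin. -/
theorem eq_zero_of_pohozaev (hN2 : 2 ≤ N) (hu : ContDiff ℝ 2 u)
    (hΔ : ∀ x, ∑ i, pderiv i (pderiv i u) x = -w x)
    {P c δ R₁ s : ℝ} (hP : 1 < P) (hc : 0 < c) (hδ : 0 < δ)
    (hcw : ∀ x, c * (u x ^ 2) ^ P ≤ u x * w x)
    (hstab : ∀ η : EuclideanSpace ℝ (Fin N) → ℝ, ContDiff ℝ 1 η → HasCompactSupport η →
      (∀ x, ‖x‖ < R₁ → η x = 0) →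
      δ * ∫ x, u x * w x * η x ^ 2 ≤ ∫ x, u x ^ 2 * ∑ i, pderiv i η x ^ 2)
    {G : EuclideanSpace ℝ (Fin N) → ℝ} (hG : ContDiff ℝ 1 G)
    (hGi : ∀ i x, pderiv i G x = w x * pderiv i u x) (hG0 : ∀ x, 0 ≤ G x)
    (hGw : ∀ x, G x ≤ u x * w x) (hwG : ∀ x, u x * w x ≤ s * G x)
    (hs : ((N : ℝ) / 2 - 1) * s < N) (hNP : (N : ℝ) < 2 * (P / (P - 1)))
    (x : EuclideanSpace ℝ (Fin N)) : G x = 0 := by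
  have hw := continuous_of_neg_laplacian hu hΔ
  obtain ⟨B, hB⟩ := exists_annulus_energy_le hu hΔ hP hc hδ hcw hstab
  obtain ⟨χ, hχ, hχ0, hχ1, hχa, hχb⟩ := exists_cutoff_ball N 1 2 one_pos one_lt_two
  have hχ' : ContDiff ℝ 1 χ := hχ.of_le (by norm_num)
  have hχs : HasCompactSupport χ := hasCompactSupport_of_le_norm fun x hx => hχb x hx.le
  obtain ⟨A, hA, hA'⟩ := exists_sum_pderiv_sq_le hχ' hχs
  set κ := (N : ℝ) / 2 - 1 with hκdef
  have hκ : 0 ≤ κ := by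
    have : (2 : ℝ) ≤ N := by exact_mod_cast hN2
    rw [hκdef]; linarith
  set D := N - κ * s with hD
  have hD0 : 0 < D := by rw [hD]; linarith
  set C := 3 + 2 * A + κ * (A + 1) with hCdef
  have hC : 0 ≤ C := by positivity
  set R₀ := max 1 (2 * R₁)
  have hχsR : ∀ R, R₀ ≤ R → HasCompactSupport fun x => χ (R⁻¹ • x) := fun R hR => by
    have hR0 : 0 < R := by linarith [le_max_left 1 (2 * R₁)]
    refine hasCompactSupport_of_le_norm (r := 2 * R) fun x hx => hχb _ ?_
    rw [norm_inv_smul hR0, le_div_iff₀ hR0]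
    exact hx.le
  have hχR : ∀ R : ℝ, ContDiff ℝ 1 fun x => χ (R⁻¹ • x) := fun R => contDiff_comp_smul hχ' R⁻¹
  refine eq_zero_of_integral_cutoff_le (R₀ := R₀) (ψ := fun R x => χ (R⁻¹ • x)) hG.continuous hG0
    (fun R hR => (hG.continuous.mul (hχR R).continuous).integrable_of_hasCompactSupport
      (hχsR R hR).mul_left) (fun R x _ => hχ0 _) (fun R x hR hx => hχa _ ?_)
    (tendsto_pow_mul_rpow N hNP (C * B / D)) (fun R hR => ?_) x
  · have hR0 : 0 < R := by linarith [le_max_left 1 (2 * R₁)]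
    rwa [norm_inv_smul hR0, div_le_one hR0]
  have hR1 : 1 ≤ R := (le_max_left _ _).trans hR
  have hR0 : 0 < R := by linarith
  obtain ⟨η, hη, hηs, hη1, hηB⟩ := hB R hR1 ((le_max_right _ _).trans hR)
  have hpoh := integral_pohozaev hu hΔ hG hGi (hχR R) (hχsR R hR)
  have hle1 : D * ∫ x, G x * χ (R⁻¹ • x)
      ≤ ∫ x, (N * G x - κ * (u x * w x)) * χ (R⁻¹ • x) := by
    rw [← integral_const_mul]
    refine integral_mono (((hG.continuous.mul
      (hχR R).continuous).integrable_of_hasCompactSupport (hχsR R hR).mul_left).const_mul D)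
      ((((continuous_const.mul hG.continuous).sub (continuous_const.mul
        (hu.continuous.mul hw))).mul (hχR R).continuous).integrable_of_hasCompactSupport
          (hχsR R hR).mul_left) fun x => ?_
    simp only
    rw [← mul_assoc]
    refine mul_le_mul_of_nonneg_right ?_ (hχ0 _)
    have := mul_le_mul_of_nonneg_left (hwG x) hκ
    rw [hD]
    linarith
  have hle2 : -∫ x, ∑ i, pderiv i (fun x => χ (R⁻¹ • x)) x * pohozaevField u G κ i x
      ≤ C * ∫ x, (∑ i, pderiv i u x ^ 2 + u x * w x + (R ^ 2)⁻¹ * u x ^ 2) * η x ^ 2 := by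
    rw [← integral_neg, ← integral_const_mul]
    refine integral_mono (((continuous_finsetSum _ fun i _ => (continuous_pderiv i (hχR R)).mul
      (contDiff_pohozaevField hu hG κ i).continuous).integrable_of_hasCompactSupport
        (hasCompactSupport_sum fun i => ((hχsR R hR).pderiv i).mul_right)).neg)
      ((integrable_mul_sq ?_ hη.continuous hηs).const_mul C) fun x => ?_
    · exact ((continuous_finsetSum _ fun i _ => (continuous_pderiv i
        (hu.of_le (by norm_num))).pow 2).add (hu.continuous.mul hw)).add
          (continuous_const.mul (hu.continuous.pow 2))
    simp only
    have hT0 : 0 ≤ ∑ i, pderiv i u x ^ 2 := Finset.sum_nonneg fun i _ => sq_nonneg _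
    have hE0 : 0 ≤ ∑ i, pderiv i u x ^ 2 + u x * w x + (R ^ 2)⁻¹ * u x ^ 2 := by
      have := (hG0 x).trans (hGw x)
      positivity
    by_cases hx : R ≤ ‖x‖ ∧ ‖x‖ ≤ 2 * R
    · refine (neg_le_abs _).trans ?_
      rw [hη1 x hx.1 hx.2, one_pow, mul_one]
      refine (abs_sum_mul_pohozaevField_le (A := A) hκ hR0 _ ?_ (hG0 x) hx.2).trans ?_
      · rw [sum_pderiv_sq_comp_smul hχ', ← mul_assoc, ← mul_pow, mul_inv_cancel₀ hR0.ne', one_pow,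
          one_mul]
        exact hA' _
      · have := hGw x
        gcongr
    · have hz : ∀ i, pderiv i (fun x => χ (R⁻¹ • x)) x = 0 := by
        intro i
        rw [not_and_or, not_le, not_le] at hx
        rcases hx with hx | hx
        · refine pderiv_eq_zero_of_eventuallyEq (c := 1) ?_ i
          filter_upwards [continuous_norm.continuousAt.eventually_lt continuousAt_const hx]
            with y hy
          exact hχa _ (by rw [norm_inv_smul hR0, div_le_one hR0]; exact hy.le)
        · refine pderiv_eq_zero_of_eventuallyEq (c := 0) ?_ i
          filter_upwards [continuousAt_const.eventually_lt continuous_norm.continuousAt hx]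
            with y hy
          exact hχb _ (by rw [norm_inv_smul hR0, le_div_iff₀ hR0]; exact hy.le)
      simp only [hz, zero_mul, Finset.sum_const_zero, neg_zero]
      positivity
  have hfin := (hle1.trans (hpoh.le.trans hle2)).trans (mul_le_mul_of_nonneg_left hηB hC)
  rw [div_mul_eq_mul_div, le_div_iff₀ hD0]
  linarith

end liouville

theorem continuousOn_deriv_mul_sq {f : ℝ → ℝ} (hC2 : ContDiffOn ℝ 2 f (Set.Ioi 0))
    (hconv : ConvexOn ℝ (Set.Ioi 0) f) (hmono : MonotoneOn f (Set.Ici 0)) :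
    ContinuousOn (fun t => deriv f t * t ^ 2) (Set.Ici 0) := by
  intro t ht
  rcases (Set.mem_Ici.1 ht).eq_or_lt with rfl | h0
  · have hsq : Tendsto (fun t : ℝ => deriv f 1 * t ^ 2) (𝓝[Set.Ici 0] 0) (𝓝 0) := by
      have : Continuous fun t : ℝ => deriv f 1 * t ^ 2 := by fun_prop
      simpa using (this.tendsto 0).mono_left nhdsWithin_le_nhds
    rw [ContinuousWithinAt]
    simp only [ne_eq, OfNat.ofNat_ne_zero, not_false_eq_true, zero_pow, mul_zero]
    refine tendsto_of_tendsto_of_tendsto_of_le_of_le' tendsto_const_nhds hsq ?_ ?_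
    · filter_upwards [self_mem_nhdsWithin] with s hs
      rcases (Set.mem_Ici.1 hs).eq_or_lt with rfl | hs
      · simp
      · exact mul_nonneg (deriv_nonneg_of_monotoneOn_Ici hmono hs) (sq_nonneg s)
    · filter_upwards [self_mem_nhdsWithin, nhdsWithin_le_nhds (Iic_mem_nhds one_pos)] with s hs hs1
      rcases (Set.mem_Ici.1 hs).eq_or_lt with rfl | hs
      · simp
      · exact mul_le_mul_of_nonneg_right (monotoneOn_deriv_of_convexOn_Ioi hC2 hconv hs
          (Set.mem_Ioi.2 one_pos) hs1) (sq_nonneg s)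
  · exact ((hasDerivAt_deriv_of_contDiffOn_Ioi hC2 h0).continuousAt.mul
      (continuousAt_id.pow 2)).continuousWithinAt

/-- Stability outside a compact set, tested against `u η`. -/
theorem exists_energy_le_of_stableOutside {N : ℕ} {f : ℝ → ℝ} {δ : ℝ}
    {u : EuclideanSpace ℝ (Fin N) → ℝ} {K : Set (EuclideanSpace ℝ (Fin N))}
    (hcont : ContinuousOn (fun t => deriv f t * t ^ 2) (Set.Ici 0)) (hu : ContDiff ℝ 2 u)
    (hu0 : ∀ x, 0 ≤ u x) (hΔ : ∀ x, ∑ i, pderiv i (pderiv i u) x = -f (u x))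
    (hδ : ∀ x, 0 < u x → δ * f (u x) ≤ u x * deriv f (u x) - f (u x))
    (hK : IsCompact K) (hstab : StableOutside (deriv f) u K) :
    ∃ R₁, ∀ η : EuclideanSpace ℝ (Fin N) → ℝ, ContDiff ℝ 1 η → HasCompactSupport η →
      (∀ x, ‖x‖ < R₁ → η x = 0) →
      δ * ∫ x, u x * f (u x) * η x ^ 2 ≤ ∫ x, u x ^ 2 * ∑ i, pderiv i η x ^ 2 := by
  have hw := continuous_of_neg_laplacian hu hΔ
  obtain ⟨R₁, -, hR₁⟩ := hK.isBounded.subset_ball_lt 0 0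
  refine ⟨R₁, fun η hη hs h0 => ?_⟩
  have hsupp : tsupport (fun x => u x * η x) ⊆ Kᶜ := by
    refine (closure_minimal (fun x hx => ?_) Metric.isOpen_ball.isClosed_compl).trans
      (Set.compl_subset_compl.2 hR₁)
    intro hx'
    refine hx ?_
    simp [h0 x (by simpa [dist_zero_right] using hx')]
  have h := hstab (fun x => u x * η x) ((hu.of_le (by norm_num)).mul hη) hs.mul_left hsupp
  simp only [norm_gradient_sq] at h
  rw [integral_sum_pderiv_mul_sq hu hΔ hη hs] at h
  have e : (fun x => deriv f (u x) * (u x * η x) ^ 2)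
      = fun x => deriv f (u x) * u x ^ 2 * η x ^ 2 := funext fun x => by ring
  rw [e] at h
  have i1 := integrable_mul_sq (v := fun x => u x * f (u x)) (hu.continuous.mul hw) hη.continuous hs
  have i2 := integrable_mul_sq (hcont.comp_continuous hu.continuous hu0) hη.continuous hs
  have hle : ∫ x, (δ + 1) * (u x * f (u x) * η x ^ 2)
      ≤ ∫ x, deriv f (u x) * u x ^ 2 * η x ^ 2 := by
    refine integral_mono (i1.const_mul _) i2 fun x => ?_
    simp only
    rw [← mul_assoc]
    refine mul_le_mul_of_nonneg_right ?_ (sq_nonneg _)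
    rcases (hu0 x).eq_or_lt with h0 | h0
    · simp [← h0]
    · nlinarith [mul_le_mul_of_nonneg_left (hδ x h0) h0.le]
  rw [integral_const_mul] at hle
  linarith

/-- Theorem 1.20: Liouville theorem in the subcritical case, under the global
assumption `(p₀+1) F(s) ≥ s f(s)` where `F(s) = ∫₀^s f`. -/
theorem stmt13 {N : ℕ} (hN : 1 ≤ N) (f : ℝ → ℝ)
    (hcont : ContinuousOn f (Set.Ici 0)) (hC2 : ContDiffOn ℝ 2 f (Set.Ioi 0))
    (hconv : ConvexOn ℝ (Set.Ioi 0) f) (hmono : MonotoneOn f (Set.Ici 0))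
    (hpos : ∀ t : ℝ, 0 < t → 0 < f t)
    (q₀ : ℝ≥0∞) (p₀ : ℝ) (hq : Tendsto (qfun f) (𝓝[>] (0:ℝ)) (𝓝 q₀))
    (hpq : 1 / ENNReal.ofReal p₀ + 1 / q₀ = 1)
    (hsub : N ≤ 2 ∨ (3 ≤ N ∧ p₀ < ((N : ℝ) + 2) / ((N : ℝ) - 2)))
    (hglob : ∀ s : ℝ, 0 ≤ s → s * f s ≤ (p₀ + 1) * ∫ t in (0:ℝ)..s, f t)
    (u : EuclideanSpace ℝ (Fin N) → ℝ) (hu : ContDiff ℝ 2 u)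
    (hbd : ∃ M, ∀ x, |u x| ≤ M) (hnonneg : ∀ x, 0 ≤ u x)
    (hsol : ∀ x, -lap u x = f (u x))
    (hstab : ∃ K : Set (EuclideanSpace ℝ (Fin N)), IsCompact K ∧
      StableOutside (deriv f) u K) :
    ∀ x, u x = 0 := by
  have hp1 : 1 ≤ p₀ := one_le_of_conjugate hpq
  have hΔ : ∀ x, ∑ i, pderiv i (pderiv i u) x = -f (u x) := fun x => by
    rw [← lap_eq_sum_pderiv hu, ← hsol x, neg_neg]
  obtain ⟨M, hM0, hM⟩ : ∃ M > 0, ∀ x, u x ≤ M := by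
    obtain ⟨M, hM⟩ := hbd
    exact ⟨max M 1, by positivity, fun x => (le_abs_self _).trans ((hM x).trans (le_max_left _ _))⟩
  have hf0 : 0 ≤ f 0 := by
    refine ge_of_tendsto ((hcont 0 Set.self_mem_Ici).mono_left (nhdsWithin_mono 0
      Set.Ioi_subset_Ici_self)) ?_
    filter_upwards [self_mem_nhdsWithin] with t ht using (hpos t ht).le
  set g : ℝ → ℝ := fun s => f (max s 0) with hg
  have hgf : ∀ {t}, 0 ≤ t → g t = f t := fun ht => by simp [hg, max_eq_left ht]
  have hgc : Continuous g := hcont.comp_continuous (by fun_prop) fun s => le_max_right s 0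
  have hgm : Monotone g := fun s t hst =>
    hmono (le_max_right s 0) (le_max_right t 0) (max_le_max_right 0 hst)
  have hgpos : ∀ t, 0 < t → 0 < g t := fun t ht => by rw [hgf ht.le]; exact hpos t ht
  have hg0 : ∀ t, 0 ≤ g t := fun t => hf0.trans (hmono Set.self_mem_Ici (le_max_right t 0)
    (le_max_right t 0))
  have hgI : ∀ t, 0 ≤ t → ∫ s in (0:ℝ)..t, f s = ∫ s in (0:ℝ)..t, g s := fun t ht =>
    intervalIntegral.integral_congr fun s hs => by
      rw [Set.uIcc_of_le ht] at hs
      exact (hgf hs.1).symm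
  have hgglob : ∀ t, 0 ≤ t → t * g t ≤ (p₀ + 1) * ∫ s in (0:ℝ)..t, g s := fun t ht => by
    rw [← hgI t ht, hgf ht]
    exact hglob t ht
  obtain ⟨c, hc, hcg⟩ := exists_rpow_le_of_mul_le_primitive hgc hgm hgpos hM0 hgglob
  have hfu : ∀ x, 0 ≤ f (u x) := fun x => by rw [← hgf (hnonneg x)]; exact hg0 _
  -- a power lower bound with a small enough exponent suffices
  have hsuper : ∀ p, 1 < p → (N : ℝ) < 2 * (p / (p - 1)) →
      (∃ c > 0, ∀ t, 0 ≤ t → t ≤ M → c * t ^ p ≤ g t) → ∀ x, u x = 0 := by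
    rintro p hp hNp ⟨c, hc, h⟩
    refine eq_zero_of_rpow_le hu hΔ hnonneg hfu hp hc (fun x => ?_) hNp
    rw [← hgf (hnonneg x)]
    exact h _ (hnonneg x) (hM x)
  rcases hsub with hN2 | ⟨hN3, hsub⟩
  · refine hsuper (p₀ + 1) (by linarith) ?_
      (exists_rpow_le_of_le hM0 (by linarith) (by linarith) hc hcg (hg0 0))
    have h2 : (N : ℝ) ≤ 2 := by exact_mod_cast hN2
    have h3 : 1 < (p₀ + 1) / (p₀ + 1 - 1) := by
      rw [one_lt_div (by linarith)]; linarith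
    linarith
  have hN3' : (3 : ℝ) ≤ N := by exact_mod_cast hN3
  have hsmall : ∀ p c : ℝ, 0 < c → p ≤ 1 → (∀ t, 0 < t → t ≤ M → c * t ^ p ≤ g t) →
      ∀ x, u x = 0 := fun p c hc hp h => by
    have hi : (0 : ℝ) < 1 / N := by positivity
    refine hsuper (1 + 1 / N) (by linarith) ?_
      (exists_rpow_le_of_le hM0 (by linarith) (by linarith) hc h (hg0 0))
    have : (1 + 1 / (N : ℝ)) / (1 + 1 / N - 1) = N + 1 := by field_simp; ring
    rw [this]
    linarith
  rcases hp1.eq_or_lt with rfl | hp1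
  · exact hsmall 1 c hc le_rfl hcg
  rcases hf0.lt_or_eq with hf0 | hf0
  · refine hsmall 0 (f 0) hf0 zero_le_one fun t ht _ => ?_
    rw [Real.rpow_zero, mul_one, hgf ht.le]
    exact hmono Set.self_mem_Ici ht.le ht.le
  obtain ⟨k, hk, ε, hε, hkε⟩ :=
    exists_mul_deriv_sq_le hC2 hconv hpos hq (ne_top_of_conjugate hpq hp1)
  obtain ⟨δ, hδ, hδM⟩ :=
    exists_mul_le_mul_deriv_sub hcont hC2 hconv hmono hpos hf0.symm hk hε hkε hM0
  obtain ⟨K, hK, hst⟩ := hstab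
  obtain ⟨R₁, hR₁⟩ := exists_energy_le_of_stableOutside
    (continuousOn_deriv_mul_sq hC2 hconv hmono) hu hnonneg hΔ
    (fun x hx => hδM _ hx (hM x)) hK hst
  rw [lt_div_iff₀ (by linarith)] at hsub
  have hPrim : ∀ t, HasDerivAt (fun t => ∫ s in (0:ℝ)..t, g s) (g t) t := hasDerivAt_primitive hgc
  have hPrimC : ContDiff ℝ 1 fun t => ∫ s in (0:ℝ)..t, g s := by
    rw [contDiff_one_iff_deriv]
    refine ⟨fun t => (hPrim t).differentiableAt, ?_⟩
    rwa [funext fun t => (hPrim t).deriv]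
  have hG : ∀ x, ∫ s in (0:ℝ)..u x, g s = 0 :=
    eq_zero_of_pohozaev (P := (p₀ + 1) / 2) (c := c) (s := p₀ + 1) (by omega) hu hΔ (by linarith)
      hc hδ (fun x => ?_) hR₁ (hPrimC.comp (hu.of_le (by norm_num))) (fun i x => ?_)
      (fun x => primitive_nonneg hg0 (hnonneg x)) (fun x => ?_) (fun x => ?_) (by linarith) ?_
  · intro x
    by_contra hne
    exact (primitive_pos hgc hgpos ((hnonneg x).lt_of_ne' hne)).ne' (hG x)
  · rw [← Real.rpow_natCast_mul (hnonneg x)]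
    rcases (hnonneg x).eq_or_lt with h0 | h0
    · rw [← h0, Real.zero_rpow (by push_cast; linarith)]
      simp
    · have e : ((2 : ℕ) : ℝ) * ((p₀ + 1) / 2) = p₀ + 1 := by push_cast; ring
      rw [e, Real.rpow_add_one h0.ne', ← hgf h0.le]
      nlinarith [mul_le_mul_of_nonneg_left (hcg _ h0 (hM x)) h0.le]
  · rw [← hgf (hnonneg x)]
    exact pderiv_comp i (hPrim (u x)) (hu.differentiable (by norm_num) x)
  · rw [← hgf (hnonneg x)]
    exact primitive_le_mul hgc hgm (hnonneg x)
  · rw [← hgf (hnonneg x)]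
    exact hgglob _ (hnonneg x)
  · have : (p₀ + 1) / 2 / ((p₀ + 1) / 2 - 1) = (p₀ + 1) / (p₀ - 1) := by
      rw [div_eq_div_iff (by linarith) (by linarith)]
      ring
    rw [this, ← mul_div_assoc, lt_div_iff₀ (by linarith)]
    linarith
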